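/- arXiv:1903.05923 — 2 statements merged into one kernel-verified Lean document; each statement's English description precedes it below -/
import Mathlib

section
/- Let f : I^d → ℝ^d be a homeomorphism onto its image and let g : I^d → ℝ^d be continuous. Then the symmetric difference g(I^d) Δ f(I^d) := (g(I^d) \ f(I^d)) ∪ (f(I^d) \ g(I^d)) is contained in the closed ‖f − g‖_∞-neighbourhood of ∂f(I^d), i.e., in { y ∈ ℝ^d : dist(y, ∂f(I^d)) ≤ sup_{x∈I^d} ‖f(x) − g(x)‖₂ }. -/
open MeasureTheory Metric Set Filter

noncomputable section

/-- `ℝ^d` with the Euclidean norm. -/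
abbrev Euc (d : ℕ) := EuclideanSpace ℝ (Fin d)

/-- The integer lattice `ℤ^d ⊆ ℝ^d`. -/
def intLattice (d : ℕ) : Set (Euc d) := {x | ∀ i, ∃ m : ℤ, x i = (m : ℝ)}

/-- The unit cube `I^d = [0,1]^d ⊆ ℝ^d`. -/
def unitCube (d : ℕ) : Set (Euc d) := {x | ∀ i, x i ∈ Icc (0:ℝ) 1}

/-- `X` is a separated net in `ℝ^d`: it is `r`-separated and an `s`-net for some `r, s > 0`. -/
def IsSeparatedNet {d : ℕ} (X : Set (Euc d)) : Prop :=
  ∃ r s : ℝ, 0 < r ∧ 0 < s ∧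
    (∀ x ∈ X, ∀ y ∈ X, x ≠ y → r ≤ dist x y) ∧
    ∀ z : Euc d, ∃ x ∈ X, dist z x ≤ s

/-- Membership of `ω : (0, a) → (0, ∞)` in the class `𝓜` of strictly increasing, concave,
submultiplicative moduli of continuity with `ω(t) ≥ t` and `ω(t) → 0` as `t → 0⁺`;
here `ω` is represented as a total function `ℝ → ℝ`, only its values on `(0, a)` matter. -/
structure MemM (ω : ℝ → ℝ) (a : ℝ) : Prop where
  a_pos : 0 < a
  a_le_one : a ≤ 1
  mono : StrictMonoOn ω (Ioo 0 a)
  concave : ConcaveOn ℝ (Ioo 0 a) ω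
  subm : ∀ s ∈ Ioo (0:ℝ) a, ∀ t ∈ Ioo (0:ℝ) a, ω (s * t) ≤ ω s * ω t
  pos : ∀ t ∈ Ioo (0:ℝ) a, 0 < ω t
  le_omega : ∀ t ∈ Ioo (0:ℝ) a, t ≤ ω t
  tendsto_zero : Tendsto ω (nhdsWithin 0 (Ioi 0)) (nhds 0)

/-- `f` is a bi-`ω`-mapping on `A` (with `ω` a modulus defined on `(0, a)`): `f` is injective on
`A` and there is `K > 0` with `dist (f x) (f y) ≤ K ω (dist x y)` and
`dist x y ≤ K ω (dist (f x) (f y))`, the bounds being imposed only when the argument of `ω` lies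
in `(0, a)`. -/
def IsBiOmegaMapOn {E F : Type*} [PseudoMetricSpace E] [PseudoMetricSpace F]
    (ω : ℝ → ℝ) (a : ℝ) (f : E → F) (A : Set E) : Prop :=
  Set.InjOn f A ∧
  ∃ K : ℝ, 0 < K ∧
    (∀ x ∈ A, ∀ y ∈ A, 0 < dist x y → dist x y < a →
      dist (f x) (f y) ≤ K * ω (dist x y)) ∧
    (∀ x ∈ A, ∀ y ∈ A, 0 < dist (f x) (f y) → dist (f x) (f y) < a →
      dist x y ≤ K * ω (dist (f x) (f y)))

/-- A set `P` in a metric space is porous. -/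
def IsPorous {E : Type*} [PseudoMetricSpace E] (P : Set E) : Prop :=
  ∀ x : E, ∃ ε₀ : ℝ, 0 < ε₀ ∧ ∃ α ∈ Ioo (0:ℝ) 1, ∀ ε ∈ Ioo (0:ℝ) ε₀,
    ∃ y : E, dist y x ≤ ε ∧ ball y (α * ε) ∩ P = ∅

/-- A set is σ-porous if it is a countable union of porous sets. -/
def IsSigmaPorous {E : Type*} [PseudoMetricSpace E] (P : Set E) : Prop :=
  ∃ F : ℕ → Set E, (∀ n, IsPorous (F n)) ∧ P = ⋃ n, F n

/-- `f : X → ℝ^d` is a homogeneous `ω`-mapping with some constant `K > 0`, for a modulus `ω`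
defined on `(0, a)`:  `‖f x₂ - f x₁‖ ≤ K R ω (‖x₂ - x₁‖ / R)` for all `R > 0` and
`x₁, x₂ ∈ X ∩ B(0, R)`, the bound being imposed only when the argument of `ω` lies in `(0,a)`. -/
def IsHomogeneousOmegaMap {d : ℕ} (ω : ℝ → ℝ) (a : ℝ)
    (A : Set (Euc d)) (f : Euc d → Euc d) : Prop :=
  ∃ K : ℝ, 0 < K ∧ ∀ R : ℝ, 0 < R → ∀ x₁ ∈ A ∩ ball 0 R, ∀ x₂ ∈ A ∩ ball 0 R,
    0 < dist x₂ x₁ / R → dist x₂ x₁ / R < a →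
      dist (f x₂) (f x₁) ≤ K * R * ω (dist x₂ x₁ / R)

/-- Two sets `X, Y ⊆ ℝ^d` are bi-`ω` equivalent: there is a bijection `f : X → Y` such that
both `f` and `f⁻¹` are homogeneous `ω`-mappings. -/
def BiOmegaEquiv {d : ℕ} (ω : ℝ → ℝ) (a : ℝ) (X Y : Set (Euc d)) : Prop :=
  ∃ f g : Euc d → Euc d, Set.BijOn f X Y ∧ Set.InvOn g f X Y ∧
    IsHomogeneousOmegaMap ω a X f ∧ IsHomogeneousOmegaMap ω a Y g

/-- A preconnected set which meets `s` but not its frontier is contained in the interior of `s`. -/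
theorem IsPreconnected.subset_interior_of_disjoint_frontier {X : Type*} [TopologicalSpace X]
    {t s : Set X} (ht : IsPreconnected t) (hts : (t ∩ s).Nonempty)
    (hd : Disjoint t (frontier s)) : t ⊆ interior s := by
  have key : ∀ x ∈ t, x ∈ closure s → x ∈ interior s := fun x hx hxc => by
    by_contra hxi
    exact Set.disjoint_left.1 hd hx ⟨hxc, hxi⟩
  obtain ⟨x, hxt, hxs⟩ := hts
  refine ht.subset_left_of_subset_union isOpen_interior isClosed_closure.isOpen_compl
    (Set.disjoint_left.2 fun z hz hz' => hz' (subset_closure (interior_subset hz)))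
    (fun z hz => ?_) ⟨x, hxt, key x hxt (subset_closure hxs)⟩
  by_cases hzc : z ∈ closure s
  · exact Or.inl (key z hz hzc)
  · exact Or.inr hzc

/-- The value at `1` of the polynomial `t ↦ det (1 + t A)` is a fixed linear combination of its
values at any `finrank + 1` distinct nodes. -/
theorem LinearMap.exists_det_one_add_eq_sum {E : Type*} [AddCommGroup E] [Module ℝ E]
    [FiniteDimensional ℝ E] {v : Fin (Module.finrank ℝ E + 1) → ℝ} (hv : Function.Injective v) :
    ∃ c : Fin (Module.finrank ℝ E + 1) → ℝ, ∀ A : E →ₗ[ℝ] E,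
      LinearMap.det (1 + A) = ∑ i, c i * LinearMap.det (1 + v i • A) := by
  classical
  refine ⟨fun i => (Lagrange.basis Finset.univ v i).eval 1, fun A => ?_⟩
  let b := Module.finBasis ℝ E
  let M := LinearMap.toMatrix b b A
  let p : Polynomial ℝ := ((Polynomial.X : Polynomial ℝ) • M.map Polynomial.C +
    (1 : Matrix _ _ ℝ).map Polynomial.C).det
  have hp : ∀ t : ℝ, p.eval t = LinearMap.det (1 + t • A) := fun t => by
    rw [← LinearMap.det_toMatrix b, ← Polynomial.coe_evalRingHom, RingHom.map_det]
    congr 1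
    ext i j
    simp [M, LinearMap.toMatrix_one, Matrix.one_apply, add_comm]
    split_ifs <;> simp [mul_comm]
  have hdeg : p.degree < (Finset.univ : Finset (Fin (Module.finrank ℝ E + 1))).card := by
    have h := Polynomial.natDegree_det_X_add_C_le M 1
    rw [Fintype.card_fin] at h
    rw [Finset.card_univ, Fintype.card_fin]
    exact Polynomial.degree_le_natDegree.trans_lt (by exact_mod_cast Nat.lt_succ_of_le h)
  have h := congrArg (Polynomial.eval 1) (Lagrange.eq_interpolate hv.injOn hdeg)
  rw [Lagrange.interpolate_apply, Polynomial.eval_finsetSum, hp, one_smul] at h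
  rw [h]
  exact Finset.sum_congr rfl fun i _ => by rw [Polynomial.eval_mul, Polynomial.eval_C, hp, mul_comm]

theorem ContinuousLinearMap.det_one_add_pos {E : Type*} [NormedAddCommGroup E] [NormedSpace ℝ E]
    [FiniteDimensional ℝ E] {A : E →L[ℝ] E} (hA : ‖A‖ < 1) : 0 < (1 + A).det := by
  have hc : ContinuousOn (fun t : ℝ => (1 + t • A).det) (Icc 0 1) :=
    (ContinuousLinearMap.continuous_det.comp (by fun_prop)).continuousOn
  have hne : ∀ t ∈ Icc (0 : ℝ) 1, (1 + t • A).det ≠ 0 := fun t ht h0 => by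
    have hker := LinearMap.bot_lt_ker_of_det_eq_zero (f := (↑(1 + t • A) : E →ₗ[ℝ] E)) h0
    obtain ⟨x, hx, hx0⟩ := (Submodule.ne_bot_iff _).1 hker.ne'
    have hx' : x + t • A x = 0 := by simpa using hx
    have h1 : ‖x‖ = t * ‖A x‖ := by
      simpa [norm_smul, abs_of_nonneg ht.1] using
        congrArg norm (eq_neg_of_add_eq_zero_left hx')
    have h2 := A.le_opNorm x
    have h3 : 0 < ‖x‖ := norm_pos_iff.2 hx0
    nlinarith [ht.1, ht.2, norm_nonneg (A x)]
  by_contra! hneg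
  obtain ⟨t, ht, h0⟩ := intermediate_value_Icc' zero_le_one hc
    (show (0 : ℝ) ∈ Icc _ _ from ⟨by simpa using hneg, by simp [ContinuousLinearMap.det]⟩)
  exact hne t ht h0

section Brouwer

variable {E : Type*} [NormedAddCommGroup E] [InnerProductSpace ℝ E] [FiniteDimensional ℝ E]

/-- A small `C¹` perturbation of the identity fixing the sphere maps the open ball bijectively
to itself. -/
theorem image_ball_eq_of_lipschitz_perturbation {w : E → E} (hw : ContDiff ℝ 1 w) {R t K : ℝ}
    (hR : 0 < R) (hfd : ∀ z ∈ closedBall (0 : E) R, ‖fderiv ℝ w z‖ ≤ K)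
    (ht : 0 ≤ t) (htK : t * K < 1)
    (hin : ∀ z ∈ ball (0 : E) R, z + t • w z ∈ ball (0 : E) R)
    (hfix : ∀ z ∈ sphere (0 : E) R, w z = 0) :
    InjOn (fun z => z + t • w z) (ball 0 R) ∧
      (fun z => z + t • w z) '' ball 0 R = ball 0 R := by
  have hd : Differentiable ℝ w := hw.differentiable one_ne_zero
  have hinj : InjOn (fun z => z + t • w z) (ball 0 R) := fun x hx y hy hxy => by
    have h1 := (convex_closedBall (0 : E) R).norm_image_sub_le_of_norm_fderiv_le
      (fun z _ => hd z) hfd (ball_subset_closedBall hx) (ball_subset_closedBall hy)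
    have h2 : y - x = -(t • (w y - w x)) := by
      have : x + t • w x = y + t • w y := hxy
      rw [smul_sub, neg_sub, sub_eq_sub_iff_add_eq_add, add_comm (t • w x), ← this]
    have h3 : ‖y - x‖ = t * ‖w y - w x‖ := by
      conv_lhs => rw [h2]
      rw [norm_neg, norm_smul, Real.norm_of_nonneg ht]
    by_contra hne
    have h4 : 0 < ‖y - x‖ := norm_pos_iff.2 (sub_ne_zero.2 (Ne.symm hne))
    nlinarith [mul_le_mul_of_nonneg_left h1 ht]
  refine ⟨hinj, (mapsTo_iff_image_subset.1 hin).antisymm ?_⟩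
  have hopen : IsOpen ((fun z => z + t • w z) '' ball 0 R) := by
    refine isOpen_iff_mem_nhds.2 ?_
    rintro _ ⟨z, hz, rfl⟩
    have hs : HasStrictFDerivAt (fun z => z + t • w z) (1 + t • fderiv ℝ w z) z :=
      (hasStrictFDerivAt_id z).add ((hw.contDiffAt.hasStrictFDerivAt one_ne_zero).const_smul t)
    have hdet : 0 < (1 + t • fderiv ℝ w z).det := by
      refine ContinuousLinearMap.det_one_add_pos ?_
      rw [norm_smul, Real.norm_of_nonneg ht]
      exact (mul_le_mul_of_nonneg_left (hfd z (ball_subset_closedBall hz)) ht).trans_lt htK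
    rw [← hs.map_nhds_eq_of_surj]
    · exact image_mem_map (isOpen_ball.mem_nhds hz)
    · by_contra hrange
      exact hdet.ne' (LinearMap.det_eq_zero_iff_ker_ne_bot.2
        (mt LinearMap.ker_eq_bot_iff_range_eq_top.1 hrange))
  refine (convex_ball (0 : E) R).isPreconnected.subset_of_closure_inter_subset hopen ?_ ?_
  · exact ⟨_, hin 0 (mem_ball_self hR), mem_image_of_mem _ (mem_ball_self hR)⟩
  · rintro y ⟨hy, hyb⟩
    have hcpt : IsCompact ((fun z => z + t • w z) '' closedBall 0 R) :=
      (isCompact_closedBall _ _).image (continuous_id.add (hw.continuous.const_smul t))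
    obtain ⟨z, hz, rfl⟩ := closure_minimal (image_mono ball_subset_closedBall) hcpt.isClosed hy
    rcases (mem_closedBall.1 hz).lt_or_eq with h | h
    · exact ⟨z, h, rfl⟩
    · have : z + t • w z ∈ ball (0 : E) R := hyb
      rw [hfix z h, smul_zero, add_zero, mem_ball, h] at this
      exact absurd this (lt_irrefl _)

variable [MeasurableSpace E] [BorelSpace E]

/-- There is no `C¹` retraction of the ball onto its boundary sphere. -/
theorem not_contDiff_retraction_sphere {G : E → E} (hG : ContDiff ℝ 1 G) {R : ℝ} (hR : 0 < R)
    (hnorm : ∀ z ∈ ball (0 : E) R, ‖G z‖ = R) (hfix : ∀ z ∈ sphere (0 : E) R, G z = z) : False := by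
  set w : E → E := fun z => G z - z with hwdef
  have hw : ContDiff ℝ 1 w := hG.sub contDiff_id
  have hcont : Continuous (fderiv ℝ w) := hw.continuous_fderiv one_ne_zero
  obtain ⟨K, hK⟩ := (isCompact_closedBall (0 : E) R).exists_bound_of_continuousOn hcont.continuousOn
  have hK0 : 0 ≤ K := (norm_nonneg _).trans (hK 0 (mem_closedBall_self hR.le))
  let v : Fin (Module.finrank ℝ E + 1) → ℝ := fun i => 1 / ((K + 1) * ((i : ℝ) + 2))
  have hvinj : Function.Injective v := fun i j hij => by
    have h1 : (K + 1) * ((i : ℝ) + 2) = (K + 1) * ((j : ℝ) + 2) := by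
      simpa [v, -mul_eq_mul_left_iff, -mul_inv_rev] using hij
    have h2 := mul_left_cancel₀ (by positivity) h1
    exact Fin.ext (by exact_mod_cast add_right_cancel h2)
  have hv0 : ∀ i, 0 < v i := fun i => by positivity
  have hvK : ∀ i, v i * (K + 1) < 1 := fun i => by
    have : v i * (K + 1) = 1 / ((i : ℝ) + 2) := by
      simp only [v]; field_simp
    rw [this, div_lt_one (by positivity)]
    linarith [Nat.cast_nonneg (α := ℝ) (i : ℕ)]
  have hv1 : ∀ i, v i < 1 := fun i => by nlinarith [hvK i, hv0 i]
  obtain ⟨c, hc⟩ := LinearMap.exists_det_one_add_eq_sum (E := E) hvinj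
  have hdet0 : ∀ z ∈ ball (0 : E) R, (1 + fderiv ℝ w z).det = 0 := fun z hz => by
    have hGd : fderiv ℝ G z = 1 + fderiv ℝ w z := by
      rw [hwdef, fderiv_fun_sub (hG.differentiable one_ne_zero z) differentiableAt_fun_id]
      simp [ContinuousLinearMap.one_def]
    have hin : ∀ x, inner ℝ (G z) (fderiv ℝ G z x) = 0 := fun x => by
      have h1 := ((hG.differentiable one_ne_zero z).hasFDerivAt.norm_sq)
      have h2 : HasFDerivAt (fun y => ‖G y‖ ^ 2) (0 : E →L[ℝ] ℝ) z := by
        refine (hasFDerivAt_const (R ^ 2) z).congr_of_eventuallyEq ?_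
        filter_upwards [isOpen_ball.mem_nhds hz] with y hy
        rw [hnorm y hy]
      have h3 := congrArg (fun L : E →L[ℝ] ℝ => L x) (h1.unique h2)
      simpa using h3
    rw [← hGd]
    refine LinearMap.det_eq_zero_iff_ker_ne_bot.2 fun hbot => ?_
    obtain ⟨x, hx⟩ := LinearMap.range_eq_top.1
      (LinearMap.ker_eq_bot_iff_range_eq_top.1 hbot) (G z)
    have h4 := hin x
    rw [show fderiv ℝ G z x = G z from hx, real_inner_self_eq_norm_sq, hnorm z hz] at h4
    exact hR.ne' (by simpa using h4)
  have hint : ∀ i, ∫ z in ball (0 : E) R, (1 + v i • fderiv ℝ w z).det =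
      volume.real (ball (0 : E) R) := fun i => by
    have hin : ∀ z ∈ ball (0 : E) R, z + v i • w z ∈ ball (0 : E) R := fun z hz => by
      have h1 : z + v i • w z = (1 - v i) • z + v i • G z := by
        simp only [hwdef]; module
      rw [mem_ball_zero_iff] at hz ⊢
      rw [h1]
      refine (norm_add_le _ _).trans_lt ?_
      rw [norm_smul, norm_smul, hnorm z (mem_ball_zero_iff.2 hz), Real.norm_of_nonneg (hv0 i).le,
        Real.norm_of_nonneg (by linarith [hv1 i])]
      nlinarith [hv1 i]
    obtain ⟨hinj, himg⟩ := image_ball_eq_of_lipschitz_perturbation hw hR hK (hv0 i).le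
      (by nlinarith [hvK i, hv0 i]) hin (fun z hz => by simp [hwdef, hfix z hz])
    have hder : ∀ z ∈ ball (0 : E) R, HasFDerivWithinAt (fun z => z + v i • w z)
        (1 + v i • fderiv ℝ w z) (ball 0 R) z := fun z _ =>
      ((hasFDerivAt_id z).add
        ((hw.differentiable one_ne_zero z).hasFDerivAt.const_smul (v i))).hasFDerivWithinAt
    have hcv := integral_image_eq_integral_abs_det_fderiv_smul volume measurableSet_ball hder hinj
      (fun _ => (1 : ℝ))
    rw [himg, setIntegral_const, smul_eq_mul, mul_one] at hcv
    rw [hcv]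
    refine setIntegral_congr_fun measurableSet_ball fun z hz => ?_
    have hpos : 0 < (1 + v i • fderiv ℝ w z).det := by
      refine ContinuousLinearMap.det_one_add_pos ?_
      rw [norm_smul, Real.norm_of_nonneg (hv0 i).le]
      nlinarith [hK z (ball_subset_closedBall hz), hvK i, hv0 i]
    simp [abs_of_pos hpos]
  have hvol : 0 < volume.real (ball (0 : E) R) :=
    ENNReal.toReal_pos (measure_ball_pos volume 0 hR).ne' measure_ball_lt_top.ne
  have hI : ∀ s : ℝ, IntegrableOn (fun z => (1 + s • fderiv ℝ w z).det) (ball (0 : E) R) :=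
    fun s => ((ContinuousLinearMap.continuous_det.comp (continuous_const.add
      (hcont.const_smul s))).continuousOn.integrableOn_compact
        (isCompact_closedBall 0 R)).mono_set ball_subset_closedBall
  -- The interpolation identity for the constant map `A = 0` computes `∑ i, c i = 1`.
  have hsum : ∑ i, c i = 1 := by simpa using (hc 0).symm
  have h1 : ∫ z in ball (0 : E) R, (1 + fderiv ℝ w z).det = volume.real (ball (0 : E) R) := by
    calc ∫ z in ball (0 : E) R, (1 + fderiv ℝ w z).det
        = ∫ z in ball (0 : E) R, ∑ i, c i * (1 + v i • fderiv ℝ w z).det :=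
          integral_congr_ae (ae_of_all _ fun z => hc (fderiv ℝ w z : E →ₗ[ℝ] E))
      _ = ∑ i, c i * ∫ z in ball (0 : E) R, (1 + v i • fderiv ℝ w z).det := by
          rw [integral_finsetSum _ fun i _ => (hI (v i)).const_mul (c i)]
          simp only [integral_const_mul]
      _ = volume.real (ball (0 : E) R) := by
          simp only [hint, ← Finset.sum_mul, hsum, one_mul]
  rw [setIntegral_congr_fun measurableSet_ball hdet0, integral_zero] at h1
  exact hvol.ne h1

theorem exists_add_eq_zero_of_contDiff_bounded {u : E → E} (hu : ContDiff ℝ 1 u) {r : ℝ}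
    (hr : ∀ z, ‖u z‖ ≤ r) : ∃ z, z + u z = 0 := by
  by_contra! hne
  have hr0 : 0 ≤ r := (norm_nonneg _).trans (hr 0)
  let χ : ContDiffBump (0 : E) := ⟨r + 1, r + 2, by linarith, by linarith⟩
  set F : E → E := fun z => z + χ z • u z with hFdef
  have hF : ContDiff ℝ 1 F := contDiff_id.add (χ.contDiff.smul hu)
  have hF0 : ∀ z, F z ≠ 0 := fun z hz => by
    have h1 : ‖z‖ ≤ r := by
      rw [eq_neg_of_add_eq_zero_left hz, norm_neg, norm_smul, Real.norm_of_nonneg χ.nonneg]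
      exact (mul_le_of_le_one_left (norm_nonneg _) χ.le_one).trans (hr z)
    have h2 : χ z = 1 := χ.one_of_mem_closedBall (by
      rw [mem_closedBall_zero_iff]; change ‖z‖ ≤ r + 1; linarith)
    exact hne z (by simpa [hFdef, h2] using hz)
  have hR : 0 < r + 2 := by linarith
  refine not_contDiff_retraction_sphere (G := fun z => ((r + 2) * ‖F z‖⁻¹) • F z)
    ((contDiff_const.mul ((hF.norm ℝ hF0).inv fun z => norm_ne_zero_iff.2 (hF0 z))).smul hF) hR
    (fun z _ => ?_) fun z hz => ?_
  · rw [norm_smul, Real.norm_of_nonneg (by positivity), mul_assoc,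
      inv_mul_cancel₀ (norm_ne_zero_iff.2 (hF0 z)), mul_one]
  · have h1 : χ z = 0 := χ.zero_of_le_dist (mem_sphere.1 hz).ge
    have h2 : F z = z := by simp [hFdef, h1]
    rw [h2, mem_sphere_zero_iff_norm.1 hz, mul_inv_cancel₀ hR.ne', one_smul]

/-- Brouwer's fixed point theorem, in the form: a bounded continuous perturbation of the identity
has a zero. -/
theorem exists_add_eq_zero_of_continuous_bounded {u : E → E} (hu : Continuous u) {r : ℝ}
    (hr : ∀ z, ‖u z‖ ≤ r) : ∃ z, z + u z = 0 := by
  by_contra! hne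
  have hr0 : 0 ≤ r := (norm_nonneg _).trans (hr 0)
  obtain ⟨z₀, -, hz₀⟩ := (isCompact_closedBall (0 : E) (r + 1)).exists_isMinOn
    ⟨0, mem_closedBall_self (by linarith)⟩ (continuous_id.add hu).norm.continuousOn
  have hδ : 0 < ‖z₀ + u z₀‖ := norm_pos_iff.2 (hne z₀)
  obtain ⟨w, hw, hwu, -⟩ := hu.exists_contDiff_approx 1
    (continuous_const (y := min 1 ‖z₀ + u z₀‖)) fun _ => lt_min one_pos hδ
  have hwr : ∀ z, ‖w z‖ ≤ r + 1 := fun z => by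
    have h1 := (hwu z).trans_le (min_le_left _ _)
    rw [dist_eq_norm] at h1
    linarith [norm_sub_norm_le (w z) (u z), hr z]
  obtain ⟨z, hz⟩ := exists_add_eq_zero_of_contDiff_bounded hw hwr
  have hzr : z ∈ closedBall (0 : E) (r + 1) := by
    rw [mem_closedBall_zero_iff, eq_neg_of_add_eq_zero_left hz, norm_neg]
    exact hwr z
  have h2 : ‖z₀ + u z₀‖ ≤ ‖z + u z‖ := hz₀ hzr
  have h3 := (hwu z).trans_le (min_le_right _ _)
  rw [dist_eq_norm, norm_sub_rev] at h3
  rw [show z + u z = u z - w z by rw [← sub_zero (z + u z), ← hz]; abel] at h2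
  exact h2.not_gt h3

/-- If `h` moves each point of the open ball of radius `ρ` by at most `r < ρ`, then `h` attains the
centre of the ball. -/
theorem exists_mem_ball_eq_center {h : E → E} {y : E} {r ρ : ℝ} (hrρ : r < ρ)
    (hρ : 0 < ρ) (hc : ContinuousOn h (ball y ρ)) (hh : ∀ z ∈ ball y ρ, dist z (h z) ≤ r) :
    ∃ z ∈ ball y ρ, h z = y := by
  have hr0 : 0 ≤ r := dist_nonneg.trans (hh y (mem_ball_self hρ))
  obtain ⟨s, hrs, hsρ⟩ := exists_between hrρ
  have hs0 : 0 < s := hr0.trans_lt hrs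
  have hmax : ∀ z : E, 0 < max s ‖z‖ := fun z => hs0.trans_le (le_max_left _ _)
  set p : E → E := fun z => y + (s / max s ‖z‖) • z with hp
  have hpc : Continuous p := continuous_const.add
    ((continuous_const.div (continuous_const.max continuous_norm) fun z => (hmax z).ne').smul
      continuous_id)
  have hpm : ∀ z, p z ∈ ball y ρ := fun z => by
    rw [mem_ball, dist_eq_norm, hp, add_sub_cancel_left, norm_smul,
      Real.norm_of_nonneg (div_nonneg hs0.le (hmax z).le), div_mul_eq_mul_div]
    exact (div_le_of_le_mul₀ (hmax z).le hs0.le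
      (mul_le_mul_of_nonneg_left (le_max_right _ _) hs0.le)).trans_lt hsρ
  have hb : ∀ z, ‖h (p z) - p z‖ ≤ r := fun z => by
    rw [← dist_eq_norm, dist_comm]; exact hh _ (hpm z)
  obtain ⟨z, hz⟩ := exists_add_eq_zero_of_continuous_bounded
    ((hc.comp_continuous hpc hpm).sub hpc) hb
  have hzs : ‖z‖ ≤ s := by
    rw [eq_neg_of_add_eq_zero_left hz, norm_neg]
    exact (hb z).trans hrs.le
  have hpz : p z = y + z := by
    rw [hp]; simp [max_eq_left hzs, div_self hs0.ne']
  refine ⟨p z, hpm z, ?_⟩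
  have h1 : z + (h (p z) - p z) = 0 := hz
  have h2 : h (p z) - y = z + (h (p z) - p z) := by
    nth_rewrite 3 [hpz]
    abel
  exact sub_eq_zero.1 (h2.trans h1)

end Brouwer

theorem isCompact_unitCube (d : ℕ) : IsCompact (unitCube d) := by
  have h : unitCube d = (EuclideanSpace.equiv (Fin d) ℝ).toHomeomorph ⁻¹'
      Set.pi univ fun _ => Icc (0 : ℝ) 1 := by
    ext x
    simp only [unitCube, mem_preimage, mem_univ_pi]
    rfl
  rw [h, Homeomorph.isCompact_preimage]
  exact isCompact_univ_pi fun _ => isCompact_Icc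

/-- Let `f : I^d → ℝ^d` be a homeomorphism onto its image (`f` is continuous
on `I^d` with continuous inverse `finv` on `f(I^d)`) and let `g : I^d → ℝ^d` be continuous.
Then the symmetric difference `g(I^d) Δ f(I^d)` is contained in the closed
`‖f - g‖_∞`-neighbourhood of `∂f(I^d)`. -/
theorem statement_7 (d : ℕ) (f g finv : Euc d → Euc d)
    (hf : ContinuousOn f (unitCube d))
    (hfinv : Set.InvOn finv f (unitCube d) (f '' unitCube d))
    (hfinvc : ContinuousOn finv (f '' unitCube d))
    (hg : ContinuousOn g (unitCube d)) :
    symmDiff (g '' unitCube d) (f '' unitCube d) ⊆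
      {y : Euc d | Metric.infDist y (frontier (f '' unitCube d)) ≤
        ⨆ x : unitCube d, dist (f x) (g x)} := by
  intro y hy
  by_contra hlt
  rw [mem_ofPred_eq, not_le] at hlt
  have hcpt := isCompact_unitCube d
  set K := f '' unitCube d
  set r := ⨆ x : unitCube d, dist (f x) (g x)
  have hr : ∀ x ∈ unitCube d, dist (f x) (g x) ≤ r := fun x hx =>
    le_ciSup (f := fun x : unitCube d => dist (f x) (g x))
      (by simpa [image_eq_range] using (hcpt.image_of_continuousOn (continuous_dist.comp_continuousOn (hf.prodMk hg))).bddAbove) ⟨x, hx⟩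
  have hρ : 0 < infDist y (frontier K) :=
    (Real.iSup_nonneg fun _ => dist_nonneg).trans_lt hlt
  have hsub : (ball y (infDist y (frontier K)) ∩ K).Nonempty →
      ball y (infDist y (frontier K)) ⊆ K := fun hne =>
    ((convex_ball y _).isPreconnected.subset_interior_of_disjoint_frontier hne
      disjoint_ball_infDist).trans interior_subset
  rcases hy with ⟨⟨x, hx, rfl⟩, hxK⟩ | ⟨hyK, hyg⟩
  · exact hxK (hsub ⟨f x, (hr x hx).trans_lt hlt, mem_image_of_mem f hx⟩ (mem_ball_self hρ))
  · have hball := hsub ⟨y, mem_ball_self hρ, hyK⟩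
    have hmem : ∀ z ∈ K, finv z ∈ unitCube d := by
      rintro _ ⟨x, hx, rfl⟩
      rwa [hfinv.1 hx]
    obtain ⟨z, hz, hzy⟩ := exists_mem_ball_eq_center (h := g ∘ finv) hlt hρ
      ((hg.comp hfinvc hmem).mono hball) fun z hz => by
        have h1 := hr _ (hmem z (hball hz))
        rwa [hfinv.2 (hball hz)] at h1
    exact hyg ⟨finv z, hmem z (hball hz), hzy⟩
end
end

section
/- Let d ∈ ℕ and let ω ∈ M be a modulus of continuity such that there exist δ > 0, C > 0 and α > (d−1)/d with ω(t) ≤ C t^α for all t ∈ (0, δ]. Suppose that for every separated net X ⊆ ℝ^d there exist constants L, U > 0 and a bijection g : X → ℤ^d satisfying L·R·ω⁻¹(‖y − x‖₂/R) ≤ ‖g(y) − g(x)‖₂ ≤ U·R·ω(‖y − x‖₂/R) for all x, y ∈ X ∩ B(0, R) and all R > 0. Then for every measurable density ρ : I^d → ℝ with 0 < inf ρ ≤ sup ρ < ∞ there is an injective bi-ω-mapping f : I^d → ℝ^d satisfying f_♯(ρ·L) = L restricted to f(I^d). -/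
open MeasureTheory Metric Set Filter

noncomputable section

/-- The lattice point with integer coordinates `z`. -/
def latEmb {d : ℕ} (z : Fin d → ℤ) : Euc d := WithLp.toLp 2 fun i => (z i : ℝ)

/-- The coordinatewise integer part. -/
def latFloor {d : ℕ} (x : Euc d) : Fin d → ℤ := fun i => ⌊x i⌋

theorem latEmb_apply {d : ℕ} (z : Fin d → ℤ) (i : Fin d) : latEmb z i = z i := rfl

theorem latEmb_injective {d : ℕ} : Function.Injective (latEmb (d := d)) := by
  intro z w h
  funext i
  have := congrArg (fun x : Euc d => x i) h
  simpa [latEmb_apply] using this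

theorem norm_le_card_mul {d : ℕ} {x : Euc d} {b : ℝ}
    (h : ∀ i, |x i| ≤ b) : ‖x‖ ≤ d * b := by
  have hx : x = ∑ i, EuclideanSpace.single i (x i) := by
    ext j
    simp [Finset.sum_apply, Pi.single_apply]
  rw [hx]
  refine (norm_sum_le _ _).trans ?_
  calc _ ≤ ∑ _i : Fin d, b := Finset.sum_le_sum fun i _ => by simpa using h i
    _ = d * b := by simp

theorem abs_apply_le_norm {d : ℕ} (x : Euc d) (i : Fin d) : |x i| ≤ ‖x‖ := by
  simpa using PiLp.norm_apply_le x i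

theorem norm_latEmb_latFloor_sub {d : ℕ} (x : Euc d) :
    ‖latEmb (latFloor x) - x‖ ≤ d := by
  have := norm_le_card_mul (x := latEmb (latFloor x) - x) (b := 1) fun i => by
    have h1 := Int.floor_le (x i)
    have h2 := Int.lt_floor_add_one (x i)
    simp only [PiLp.sub_apply, latEmb_apply, latFloor]
    rw [abs_le]
    constructor <;> linarith
  simpa using this

theorem measurable_latFloor {d : ℕ} : Measurable (latFloor (d := d)) := by
  refine measurable_pi_iff.2 fun i => ?_
  exact Int.measurable_floor.comp (by fun_prop)

theorem volume_latFloor_preimage {d : ℕ} (z : Fin d → ℤ) :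
    volume (latFloor ⁻¹' {z} : Set (Euc d)) = 1 := by
  have h : (latFloor ⁻¹' {z} : Set (Euc d))
      = WithLp.ofLp ⁻¹' (univ.pi fun i => Ico (z i : ℝ) (z i + 1)) := by
    ext x
    simp only [mem_preimage, mem_singleton_iff, latFloor, Set.mem_pi, mem_univ, true_imp_iff,
      mem_Ico, funext_iff, Int.floor_eq_iff]
  rw [h, (PiLp.volume_preserving_ofLp (Fin d)).measure_preimage
    (MeasurableSet.univ_pi fun i => measurableSet_Ico).nullMeasurableSet, Real.volume_pi_Ico]
  simp

theorem finite_norm_latEmb_le {d : ℕ} (r : ℝ) : {z : Fin d → ℤ | ‖latEmb z‖ ≤ r}.Finite := by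
  refine (Set.Finite.pi' fun _ : Fin d => Set.finite_Icc (-⌈r⌉) ⌈r⌉).subset ?_
  intro z hz i
  have h1 := (abs_apply_le_norm (latEmb z) i).trans hz
  rw [latEmb_apply, abs_le] at h1
  have h2 := Int.le_ceil r
  constructor
  · have : (-(⌈r⌉ : ℝ)) ≤ z i := by linarith
    exact_mod_cast this
  · have : (z i : ℝ) ≤ ⌈r⌉ := by linarith
    exact_mod_cast this

/-- Weighted lattice sums are integrals over the space. -/
theorem integral_mul_comp_latFloor {d : ℕ} {P : Euc d → ℝ} (hP : Measurable P)
    {B : ℝ} (hB : ∀ x, |P x| ≤ B) {φ : (Fin d → ℤ) → ℝ} (hφ : φ.support.Finite) :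
    ∫ x, P x * φ (latFloor x) = ∑' z, (∫ x in latFloor ⁻¹' {z}, P x) * φ z := by
  have hm : ∀ z : Fin d → ℤ,
      MeasurableSet (latFloor ⁻¹' {z} : Set (Euc d)) := fun z =>
    measurable_latFloor (measurableSet_singleton z)
  have hPint : ∀ z : Fin d → ℤ, IntegrableOn (fun x => P x * φ z)
      (latFloor ⁻¹' {z} : Set (Euc d)) := fun z => by
    refine Integrable.mul_const ?_ _
    refine IntegrableOn.of_bound (by simp [volume_latFloor_preimage])
      hP.aestronglyMeasurable B (ae_of_all _ fun x => by simpa using hB x)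
  have h1 : (fun x => P x * φ (latFloor x)) = fun x => ∑ z ∈ hφ.toFinset,
      (latFloor ⁻¹' {z} : Set (Euc d)).indicator (fun x => P x * φ z) x := by
    funext x
    rw [Finset.sum_eq_single (latFloor x)]
    · simp
    · intro z _ hz
      exact indicator_of_notMem (fun h => hz h.symm) _
    · intro h
      simp only [Finite.mem_toFinset, Function.mem_support, not_not] at h
      simp [h]
  rw [h1, integral_finsetSum _ fun z _ => (hPint z).integrable_indicator (hm z),
    tsum_eq_sum (s := hφ.toFinset)]
  · refine Finset.sum_congr rfl fun z _ => ?_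
    rw [integral_indicator (hm z), integral_mul_const]
  · intro z hz
    simp only [Finite.mem_toFinset, Function.mem_support, not_not] at hz
    simp [hz]

theorem four_pow_inv_pos (k : ℕ) : (0 : ℝ) < ((4 : ℝ) ^ k)⁻¹ := by positivity

theorem tendsto_four_pow_inv : Tendsto (fun k : ℕ => ((4 : ℝ) ^ k)⁻¹) atTop (nhds 0) :=
  tendsto_inv_atTop_zero.comp (tendsto_pow_atTop_atTop_of_one_lt (by norm_num))

theorem four_pow_inv_le_one (k : ℕ) : ((4 : ℝ) ^ k)⁻¹ ≤ 1 :=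
  inv_le_one_of_one_le₀ (one_le_pow₀ (by norm_num))

/-- Rescaled form of `integral_mul_comp_latFloor` for a weight invariant under dilation. -/
theorem integral_mul_comp_latFloor_scaled {d : ℕ} {P : Euc d → ℝ}
    (hP : Measurable P) {B : ℝ} (hB : ∀ x, |P x| ≤ B)
    (hinv : ∀ (k : ℕ) x, P ((4 : ℝ) ^ k • x) = P x)
    {φ : (Fin d → ℤ) → ℝ} (hφ : φ.support.Finite) (k : ℕ) :
    ((4 : ℝ) ^ k)⁻¹ ^ d * ∑' z, (∫ x in latFloor ⁻¹' {z}, P x) * φ z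
      = ∫ x, P x * φ (latFloor ((4 : ℝ) ^ k • x)) := by
  have h := Measure.integral_comp_smul (volume : Measure (Euc d))
    (fun x => P x * φ (latFloor x)) ((4 : ℝ) ^ k)
  simp only [hinv, finrank_euclideanSpace, Fintype.card_fin, smul_eq_mul] at h
  rw [h, ← integral_mul_comp_latFloor hP hB hφ, abs_of_pos (by positivity), inv_pow]

theorem tsum_eq_integral_latFloor_scaled {d : ℕ} {φ : (Fin d → ℤ) → ℝ} (hφ : φ.support.Finite)
    (k : ℕ) : ((4 : ℝ) ^ k)⁻¹ ^ d * ∑' z, φ z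
      = ∫ x : Euc d, φ (latFloor ((4 : ℝ) ^ k • x)) := by
  have h := integral_mul_comp_latFloor_scaled (P := fun _ : Euc d => (1 : ℝ))
    measurable_const (B := 1) (by simp) (by simp) hφ k
  simpa [measureReal_def, volume_latFloor_preimage] using h

theorem norm_scaled_latFloor_sub {d : ℕ} (k : ℕ) (x : Euc d) :
    ‖((4 : ℝ) ^ k)⁻¹ • latEmb (latFloor ((4 : ℝ) ^ k • x)) - x‖ ≤ ((4 : ℝ) ^ k)⁻¹ * d := by
  have h : ((4 : ℝ) ^ k)⁻¹ • latEmb (latFloor ((4 : ℝ) ^ k • x)) - x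
      = ((4 : ℝ) ^ k)⁻¹ • (latEmb (latFloor ((4 : ℝ) ^ k • x)) - (4 : ℝ) ^ k • x) := by
    rw [smul_sub, smul_smul, inv_mul_cancel₀ (by positivity), one_smul]
  rw [h, norm_smul, Real.norm_of_nonneg (four_pow_inv_pos k).le]
  exact mul_le_mul_of_nonneg_left (norm_latEmb_latFloor_sub _) (four_pow_inv_pos k).le

theorem norm_le_of_norm_scaled_latFloor_le {d : ℕ} {k : ℕ} {x : Euc d} {R : ℝ}
    (h : ‖((4 : ℝ) ^ k)⁻¹ • latEmb (latFloor ((4 : ℝ) ^ k • x))‖ ≤ R) : ‖x‖ ≤ R + d := by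
  have h1 := norm_scaled_latFloor_sub k x
  have h2 : ((4 : ℝ) ^ k)⁻¹ * d ≤ d :=
    mul_le_of_le_one_left (by positivity) (four_pow_inv_le_one k)
  have h3 := norm_sub_norm_le x (((4 : ℝ) ^ k)⁻¹ • latEmb (latFloor ((4 : ℝ) ^ k • x)))
  rw [norm_sub_rev] at h3
  linarith

theorem finite_support_of_scaled {d : ℕ} {k : ℕ} {R : ℝ} {φ : (Fin d → ℤ) → ℝ}
    (h0 : ∀ z, R < ‖((4 : ℝ) ^ k)⁻¹ • latEmb z‖ → φ z = 0) : φ.support.Finite := by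
  refine (finite_norm_latEmb_le ((4 : ℝ) ^ k * R)).subset fun z hz => ?_
  by_contra hc
  refine hz (h0 z ?_)
  rw [norm_smul, Real.norm_of_nonneg (four_pow_inv_pos k).le]
  rw [mem_ofPred_eq, not_le] at hc
  rw [inv_mul_eq_div, lt_div_iff₀ (by positivity)]
  linarith

theorem abs_scaled_tsum_le {d : ℕ} {k : ℕ} {R ε : ℝ} {φ : (Fin d → ℤ) → ℝ}
    (h0 : ∀ z, R < ‖((4 : ℝ) ^ k)⁻¹ • latEmb z‖ → φ z = 0) (hε : ∀ z, |φ z| ≤ ε) :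
    |((4 : ℝ) ^ k)⁻¹ ^ d * ∑' z, φ z|
      ≤ ε * volume.real (closedBall (0 : Euc d) (R + d)) := by
  rw [tsum_eq_integral_latFloor_scaled (finite_support_of_scaled h0),
    ← setIntegral_eq_integral_of_forall_compl_eq_zero (s := closedBall 0 (R + d))]
  · exact norm_setIntegral_le_of_norm_le_const
      (f := fun x => φ (latFloor ((4 : ℝ) ^ k • x))) measure_closedBall_lt_top fun x _ => hε _
  · intro x hx
    refine h0 _ ?_
    by_contra hc
    exact hx (mem_closedBall_zero_iff.2 (norm_le_of_norm_scaled_latFloor_le (not_lt.1 hc)))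

theorem exists_bound_of_hasCompactSupport {E : Type*} [NormedAddCommGroup E] {ψ : E → ℝ}
    (hc : HasCompactSupport ψ) : ∃ r, 0 < r ∧ ∀ x, r < ‖x‖ → ψ x = 0 := by
  obtain ⟨r, hr⟩ := hc.isCompact.isBounded.exists_norm_le
  refine ⟨max r 1, by positivity, fun x hx => ?_⟩
  by_contra h
  have := hr x (subset_tsupport _ h)
  have := le_max_left r 1
  linarith

/-- Convergence of weighted Riemann sums on finer and finer lattices. -/
theorem tendsto_scaled_tsum_weighted {d : ℕ} {P : Euc d → ℝ}
    (hP : Measurable P) {B : ℝ} (hB : ∀ x, |P x| ≤ B)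
    (hinv : ∀ (k : ℕ) x, P ((4 : ℝ) ^ k • x) = P x)
    {ψ : Euc d → ℝ} (hψ : Continuous ψ) (hc : HasCompactSupport ψ) :
    Tendsto (fun k : ℕ => ((4 : ℝ) ^ k)⁻¹ ^ d *
      ∑' z, (∫ x in latFloor ⁻¹' {z}, P x) * ψ (((4 : ℝ) ^ k)⁻¹ • latEmb z)) atTop
      (nhds (∫ x, P x * ψ x)) := by
  obtain ⟨r, hr, hsupp⟩ := exists_bound_of_hasCompactSupport hc
  obtain ⟨D, hD⟩ := hψ.bounded_above_of_compact_support hc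
  have hB0 : 0 ≤ B := (abs_nonneg _).trans (hB 0)
  have hD0 : 0 ≤ D := (norm_nonneg _).trans (hD 0)
  have heq : ∀ k : ℕ, ((4 : ℝ) ^ k)⁻¹ ^ d *
      ∑' z, (∫ x in latFloor ⁻¹' {z}, P x) * ψ (((4 : ℝ) ^ k)⁻¹ • latEmb z)
      = ∫ x, P x * ψ (((4 : ℝ) ^ k)⁻¹ • latEmb (latFloor ((4 : ℝ) ^ k • x))) := fun k =>
    integral_mul_comp_latFloor_scaled hP hB hinv
      (φ := fun z => ψ (((4 : ℝ) ^ k)⁻¹ • latEmb z))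
      (finite_support_of_scaled fun z hz => hsupp _ hz) k
  simp only [heq]
  refine tendsto_integral_of_dominated_convergence
    ((closedBall (0 : Euc d) (r + d)).indicator fun _ => B * D) ?_ ?_ ?_ ?_
  · intro k
    refine (hP.mul ?_).aestronglyMeasurable
    have h1 : Measurable fun z : Fin d → ℤ => ψ (((4 : ℝ) ^ k)⁻¹ • latEmb z) :=
      measurable_of_countable _
    exact h1.comp (measurable_latFloor.comp (measurable_const_smul _))
  · exact (integrable_indicator_iff measurableSet_closedBall).2
      (integrableOn_const measure_closedBall_lt_top.ne)
  · intro k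
    refine ae_of_all _ fun x => ?_
    by_cases hx : x ∈ closedBall (0 : Euc d) (r + d)
    · rw [indicator_of_mem hx, norm_mul]
      exact mul_le_mul (hB x) (hD _) (norm_nonneg _) hB0
    · rw [indicator_of_notMem hx, hsupp]
      · simp
      · by_contra hcon
        exact hx (mem_closedBall_zero_iff.2 (norm_le_of_norm_scaled_latFloor_le (not_lt.1 hcon)))
  · refine ae_of_all _ fun x => (tendsto_const_nhds).mul ((hψ.tendsto x).comp ?_)
    rw [tendsto_iff_norm_sub_tendsto_zero]
    refine squeeze_zero (fun _ => norm_nonneg _) (fun k => norm_scaled_latFloor_sub k x) ?_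
    simpa using tendsto_four_pow_inv.mul_const (d : ℝ)

theorem exists_antidifference (a : ℤ → ℝ) : ∃ G : ℤ → ℝ, ∀ n, G (n + 1) - G n = a n := by
  refine ⟨fun n => ∑ j ∈ Finset.Ico 0 n, a j - ∑ j ∈ Finset.Ico n 0, a j, fun n => ?_⟩
  rcases le_or_gt 0 n with hn | hn
  · have h1 : Finset.Ico 0 (n + 1) = insert n (Finset.Ico 0 n) := by
      ext j
      simp only [Finset.mem_Ico, Finset.mem_insert]
      lia
    beta_reduce
    rw [h1, Finset.sum_insert (by simp), Finset.Ico_eq_empty (a := n) (by lia),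
      Finset.Ico_eq_empty (a := n + 1) (by lia)]
    simp
  · have h1 : Finset.Ico n 0 = insert n (Finset.Ico (n + 1) 0) := by
      ext j
      simp only [Finset.mem_Ico, Finset.mem_insert]
      lia
    beta_reduce
    rw [h1, Finset.sum_insert (by simp), Finset.Ico_eq_empty (a := 0) (b := n) (by lia),
      Finset.Ico_eq_empty (a := 0) (b := n + 1) (by lia)]
    simp

/-- A set of lattice points with bounded gaps whose indicator differs from the weight `w` by a
bounded coboundary. -/
theorem exists_set_of_weight {d : ℕ} (i₀ : Fin d) {w : (Fin d → ℤ) → ℝ} {θ : ℝ} (hθ : 0 < θ)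
    (hw : ∀ z, θ ≤ w z) (hw1 : ∀ z, w z ≤ 1) :
    ∃ (S : Set (Fin d → ℤ)) (G : (Fin d → ℤ) → ℝ), (∀ z, |G z| ≤ 1) ∧
      (∀ z, S.indicator 1 z - w z = G z - G (z + Pi.single i₀ 1)) ∧
      ∃ N : ℕ, ∀ z, ∃ j : ℕ, j ≤ N ∧ z + j • (Pi.single i₀ 1 : Fin d → ℤ) ∈ S := by
  obtain ⟨F, hF⟩ : ∃ F : (Fin d → ℤ) → ℝ, ∀ z, F (z + Pi.single i₀ 1) - F z = w z := by
    choose A hA using fun z : Fin d → ℤ =>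
      exists_antidifference fun j => w (Function.update z i₀ j)
    refine ⟨fun z => A (Function.update z i₀ 0) (z i₀), fun z => ?_⟩
    have h1 : Function.update (z + Pi.single i₀ 1) i₀ 0 = Function.update z i₀ 0 := by
      funext i
      by_cases hi : i = i₀
      · subst hi; simp
      · simp [hi]
    have h2 := hA (Function.update z i₀ 0) (z i₀)
    simpa [h1] using h2
  have hstep : ∀ z, ⌊F z⌋ ≤ ⌊F (z + Pi.single i₀ 1)⌋ ∧
      ⌊F (z + Pi.single i₀ 1)⌋ ≤ ⌊F z⌋ + 1 := fun z => by
    have h1 := hF z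
    have h2 := hw z
    have h3 := hw1 z
    refine ⟨Int.floor_le_floor (by linarith), ?_⟩
    rw [← Int.floor_add_one]
    exact Int.floor_le_floor (by linarith)
  refine ⟨{z | ⌊F (z + Pi.single i₀ 1)⌋ = ⌊F z⌋ + 1}, fun z => Int.fract (F z), fun z => ?_,
    fun z => ?_, ⌈θ⁻¹⌉₊, fun z => ?_⟩
  · rw [abs_of_nonneg (Int.fract_nonneg _)]
    exact (Int.fract_lt_one _).le
  · rw [← hF z]
    simp only [Int.fract]
    by_cases hz : ⌊F (z + Pi.single i₀ 1)⌋ = ⌊F z⌋ + 1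
    · rw [indicator_of_mem (by exact hz), hz]
      push_cast
      simp only [Pi.one_apply]
      ring
    · rw [indicator_of_notMem (by exact hz)]
      have : ⌊F (z + Pi.single i₀ 1)⌋ = ⌊F z⌋ := by
        have := hstep z
        lia
      rw [this]
      ring
  · by_contra! hcon
    have key : ∀ j : ℕ, j ≤ ⌈θ⁻¹⌉₊ → ⌊F (z + j • Pi.single i₀ 1)⌋ = ⌊F z⌋ ∧
        F z + j * θ ≤ F (z + j • Pi.single i₀ 1) := by
      intro j
      induction j with
      | zero => simp
      | succ j ih =>
        intro hj
        obtain ⟨h1, h2⟩ := ih (by lia)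
        have h3 := hcon j (by lia)
        have h4 := hstep (z + j • Pi.single i₀ 1)
        have h5 := hF (z + j • Pi.single i₀ 1)
        have h6 := hw (z + j • Pi.single i₀ 1)
        rw [mem_ofPred_eq] at h3
        rw [add_assoc, ← succ_nsmul] at h3 h4 h5
        refine ⟨by lia, ?_⟩
        push_cast
        linarith
    obtain ⟨h1, h2⟩ := key _ le_rfl
    have h3 : 1 ≤ (⌈θ⁻¹⌉₊ : ℝ) * θ := by
      have := Nat.le_ceil θ⁻¹
      calc (1 : ℝ) = θ⁻¹ * θ := (inv_mul_cancel₀ hθ.ne').symm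
        _ ≤ _ := mul_le_mul_of_nonneg_right this hθ.le
    have h4 : ⌊F z + 1⌋ ≤ ⌊F (z + ⌈θ⁻¹⌉₊ • Pi.single i₀ 1)⌋ :=
      Int.floor_le_floor (by linarith)
    rw [Int.floor_add_one] at h4
    lia

theorem latEmb_add {d : ℕ} (z w : Fin d → ℤ) : latEmb (z + w) = latEmb z + latEmb w := by
  ext i
  simp [latEmb_apply]

theorem norm_latEmb_nsmul_single {d : ℕ} (i : Fin d) (j : ℕ) :
    ‖latEmb (j • Pi.single i 1 : Fin d → ℤ)‖ = j := by
  have : latEmb (j • Pi.single i 1 : Fin d → ℤ) = EuclideanSpace.single i (j : ℝ) := by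
    ext l
    by_cases hl : l = i
    · subst hl; simp [latEmb_apply]
    · simp [latEmb_apply, hl]
  rw [this]
  simp

theorem one_le_dist_latEmb {d : ℕ} {z w : Fin d → ℤ} (h : z ≠ w) :
    1 ≤ dist (latEmb z) (latEmb w) := by
  obtain ⟨i, hi⟩ := Function.ne_iff.1 h
  rw [dist_eq_norm]
  refine le_trans ?_ (abs_apply_le_norm _ i)
  rw [PiLp.sub_apply, latEmb_apply, latEmb_apply]
  exact_mod_cast Int.one_le_abs (sub_ne_zero.2 hi)

theorem isSeparatedNet_image_latEmb {d : ℕ} (i₀ : Fin d) {S : Set (Fin d → ℤ)} {N : ℕ}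
    (hN : ∀ z, ∃ j : ℕ, j ≤ N ∧ z + j • (Pi.single i₀ 1 : Fin d → ℤ) ∈ S) :
    IsSeparatedNet (latEmb '' S) := by
  refine ⟨1, d + N + 1, one_pos, by positivity, ?_, fun x => ?_⟩
  · rintro _ ⟨z, -, rfl⟩ _ ⟨w, -, rfl⟩ h
    exact one_le_dist_latEmb fun h' => h (by rw [h'])
  · obtain ⟨j, hj, hS⟩ := hN (latFloor x)
    refine ⟨_, ⟨_, hS, rfl⟩, ?_⟩
    have h1 := dist_triangle x (latEmb (latFloor x))
      (latEmb (latFloor x + j • Pi.single i₀ 1))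
    have h2 := norm_latEmb_latFloor_sub x
    have h3 : dist (latEmb (latFloor x)) (latEmb (latFloor x + j • Pi.single i₀ 1)) = j := by
      rw [latEmb_add, dist_self_add_right, norm_latEmb_nsmul_single]
    rw [← dist_eq_norm, dist_comm] at h2
    have : (j : ℝ) ≤ N := by exact_mod_cast hj
    linarith

/-- Summation by parts: a bounded coboundary is asymptotically invisible to Riemann sums. -/
theorem tendsto_scaled_tsum_coboundary {d : ℕ} (i₀ : Fin d) {u G : (Fin d → ℤ) → ℝ}
    (hG : ∀ z, |G z| ≤ 1) (hu : ∀ z, u z = G z - G (z + Pi.single i₀ 1))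
    {ψ : Euc d → ℝ} (hψ : Continuous ψ) (hc : HasCompactSupport ψ) :
    Tendsto (fun k : ℕ => ((4 : ℝ) ^ k)⁻¹ ^ d * ∑' z, u z * ψ (((4 : ℝ) ^ k)⁻¹ • latEmb z))
      atTop (nhds 0) := by
  obtain ⟨r, hr, hsupp⟩ := exists_bound_of_hasCompactSupport hc
  have huc := Metric.uniformContinuous_iff.1 (hc.uniformContinuous_of_continuous hψ)
  set e : Fin d → ℤ := Pi.single i₀ 1 with he
  set V := volume.real (closedBall (0 : Euc d) (r + 1 + d))
  have hV : 0 ≤ V := measureReal_nonneg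
  have hnorm : ∀ (k : ℕ) z, dist (((4 : ℝ) ^ k)⁻¹ • latEmb z) (((4 : ℝ) ^ k)⁻¹ • latEmb (z - e))
      = ((4 : ℝ) ^ k)⁻¹ := fun k z => by
    have h1 : ‖latEmb e‖ = 1 := by simpa using norm_latEmb_nsmul_single i₀ 1
    have h2 : latEmb z = latEmb (z - e) + latEmb e := by rw [← latEmb_add, sub_add_cancel]
    rw [dist_smul₀, Real.norm_of_nonneg (four_pow_inv_pos k).le, h2, dist_self_add_left, h1,
      mul_one]
  have hzero : ∀ (k : ℕ) z, r + 1 < ‖((4 : ℝ) ^ k)⁻¹ • latEmb z‖ →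
      ψ (((4 : ℝ) ^ k)⁻¹ • latEmb z) = 0 ∧ ψ (((4 : ℝ) ^ k)⁻¹ • latEmb (z - e)) = 0 := by
    intro k z hz
    refine ⟨hsupp _ (by linarith), hsupp _ ?_⟩
    have h1 := norm_sub_norm_le (((4 : ℝ) ^ k)⁻¹ • latEmb z) (((4 : ℝ) ^ k)⁻¹ • latEmb (z - e))
    rw [← dist_eq_norm, hnorm] at h1
    have := four_pow_inv_le_one k
    linarith
  have hparts : ∀ k : ℕ, ∑' z, u z * ψ (((4 : ℝ) ^ k)⁻¹ • latEmb z)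
      = ∑' z, G z * (ψ (((4 : ℝ) ^ k)⁻¹ • latEmb z) - ψ (((4 : ℝ) ^ k)⁻¹ • latEmb (z - e))) := by
    intro k
    have hs1 : Summable fun z => G z * ψ (((4 : ℝ) ^ k)⁻¹ • latEmb z) :=
      summable_of_hasFiniteSupport (finite_support_of_scaled (R := r + 1) (k := k) fun z hz => by
        simp [(hzero k z hz).1])
    have hs2 : Summable fun z => G z * ψ (((4 : ℝ) ^ k)⁻¹ • latEmb (z - e)) :=
      summable_of_hasFiniteSupport (finite_support_of_scaled (R := r + 1) (k := k) fun z hz => by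
        simp [(hzero k z hz).2])
    have hshift : (fun z => G (z + e) * ψ (((4 : ℝ) ^ k)⁻¹ • latEmb z))
        = (fun z => G z * ψ (((4 : ℝ) ^ k)⁻¹ • latEmb (z - e))) ∘ Equiv.addRight e := by
      funext z
      simp
    have hs3 := (Equiv.addRight e).summable_iff.2 hs2
    simp only [hu, sub_mul, mul_sub]
    rw [hs1.tsum_sub hs2, hs1.tsum_sub (hshift ▸ hs3), hshift]
    congr 1
    exact (Equiv.addRight e).tsum_eq fun z => G z * ψ (((4 : ℝ) ^ k)⁻¹ • latEmb (z - e))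
  rw [Metric.tendsto_atTop]
  intro ε hε
  obtain ⟨η, hη, hηψ⟩ := huc (ε / (V + 1)) (by positivity)
  obtain ⟨K, hK⟩ := eventually_atTop.1 (tendsto_four_pow_inv.eventually (gt_mem_nhds hη))
  refine ⟨K, fun k hk => ?_⟩
  rw [Real.dist_eq, sub_zero, hparts]
  refine (abs_scaled_tsum_le (R := r + 1) (ε := ε / (V + 1)) (fun z hz => ?_)
    fun z => ?_).trans_lt ?_
  · simp [hzero k z hz]
  · rw [abs_mul]
    have := hηψ ((hnorm k z).trans_lt (hK k hk))
    rw [Real.dist_eq] at this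
    exact (mul_le_mul (hG z) this.le (abs_nonneg _) zero_le_one).trans_eq (one_mul _)
  · change ε / (V + 1) * V < ε
    rw [div_mul_eq_mul_div, div_lt_iff₀ (by positivity)]
    nlinarith

/-- `p` is controlled by `q` on `X`, homogeneously at every scale, with modulus `W`. -/
def HomBound {d : ℕ} (W : ℝ → ℝ) (X : Set (Euc d)) (p q : Euc d → Euc d) : Prop :=
  ∀ R : ℝ, 0 < R → ∀ x ∈ X, ∀ y ∈ X, ‖x‖ < R → ‖y‖ < R →
    dist (p x) (p y) ≤ R * W (dist (q x) (q y) / R)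

theorem HomBound.scaled {d : ℕ} {W : ℝ → ℝ} {X : Set (Euc d)} {p q : Euc d → Euc d}
    (h : HomBound W X p q) (k : ℕ) {R : ℝ} (hR : 0 < R) {x y : Euc d} (hx : x ∈ X) (hy : y ∈ X)
    (hxR : ‖((4 : ℝ) ^ k)⁻¹ • x‖ < R) (hyR : ‖((4 : ℝ) ^ k)⁻¹ • y‖ < R) :
    dist (((4 : ℝ) ^ k)⁻¹ • p x) (((4 : ℝ) ^ k)⁻¹ • p y)
      ≤ R * W (dist (((4 : ℝ) ^ k)⁻¹ • q x) (((4 : ℝ) ^ k)⁻¹ • q y) / R) := by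
  have hc := four_pow_inv_pos k
  have h4 : (0 : ℝ) < (4 : ℝ) ^ k := by positivity
  rw [norm_smul, Real.norm_of_nonneg hc.le, inv_mul_lt_iff₀ h4] at hxR hyR
  have := h ((4 : ℝ) ^ k * R) (by positivity) x hx y hy hxR hyR
  rw [dist_smul₀, dist_smul₀, Real.norm_of_nonneg hc.le, inv_mul_le_iff₀ h4]
  refine this.trans_eq ?_
  rw [mul_assoc]
  congr 3
  field_simp

theorem HomBound.of_tendsto {d : ℕ} {W : ℝ → ℝ} {X : Set (Euc d)} {p q : Euc d → Euc d}
    (h : HomBound W X p q) (hW : Continuous W) {l : Filter ℕ} [l.NeBot] {R : ℝ} (hR : 0 < R)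
    {xs ys : ℕ → Euc d} (hxs : ∀ k, xs k ∈ X) (hys : ∀ k, ys k ∈ X) {x y px py qx qy : Euc d}
    (hx : Tendsto (fun k => ((4 : ℝ) ^ k)⁻¹ • xs k) l (nhds x))
    (hy : Tendsto (fun k => ((4 : ℝ) ^ k)⁻¹ • ys k) l (nhds y))
    (hpx : Tendsto (fun k => ((4 : ℝ) ^ k)⁻¹ • p (xs k)) l (nhds px))
    (hpy : Tendsto (fun k => ((4 : ℝ) ^ k)⁻¹ • p (ys k)) l (nhds py))
    (hqx : Tendsto (fun k => ((4 : ℝ) ^ k)⁻¹ • q (xs k)) l (nhds qx))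
    (hqy : Tendsto (fun k => ((4 : ℝ) ^ k)⁻¹ • q (ys k)) l (nhds qy))
    (hxR : ‖x‖ < R) (hyR : ‖y‖ < R) :
    dist px py ≤ R * W (dist qx qy / R) := by
  refine le_of_tendsto_of_tendsto (hpx.dist hpy)
    (tendsto_const_nhds.mul ((hW.tendsto _).comp ((hqx.dist hqy).div_const R))) ?_
  filter_upwards [hx.norm.eventually (gt_mem_nhds hxR), hy.norm.eventually (gt_mem_nhds hyR)]
    with k hxk hyk
  exact h.scaled k hR (hxs k) (hys k) hxk hyk

theorem exists_tendsto_scaled_net {d : ℕ} {X : Set (Euc d)} {s : ℝ}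
    (hX : ∀ z : Euc d, ∃ x ∈ X, dist z x ≤ s) (y : Euc d) :
    ∃ xs : ℕ → Euc d, (∀ k, xs k ∈ X) ∧
      Tendsto (fun k => ((4 : ℝ) ^ k)⁻¹ • xs k) atTop (nhds y) := by
  choose π hπX hπ using hX
  refine ⟨fun k => π ((4 : ℝ) ^ k • y), fun k => hπX _, ?_⟩
  rw [tendsto_iff_dist_tendsto_zero]
  refine squeeze_zero (fun _ => dist_nonneg) (g := fun k : ℕ => ((4 : ℝ) ^ k)⁻¹ * s)
    (fun k => ?_) ?_
  · have h : y = ((4 : ℝ) ^ k)⁻¹ • (4 : ℝ) ^ k • y := by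
      rw [smul_smul, inv_mul_cancel₀ (by positivity), one_smul]
    nth_rewrite 2 [h]
    rw [dist_smul₀, Real.norm_of_nonneg (four_pow_inv_pos k).le, dist_comm]
    exact mul_le_mul_of_nonneg_left (hπ _) (four_pow_inv_pos k).le
  · simpa using tendsto_four_pow_inv.mul_const s

/-- `f` is the blow-down of `g : X → ℝ^d` along the ultrafilter `l`. -/
def IsBlowdown {d : ℕ} (l : Ultrafilter ℕ) (X : Set (Euc d)) (g f : Euc d → Euc d) : Prop :=
  ∀ y, ∀ xs : ℕ → Euc d, (∀ k, xs k ∈ X) →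
    Tendsto (fun k => ((4 : ℝ) ^ k)⁻¹ • xs k) l (nhds y) →
    Tendsto (fun k => ((4 : ℝ) ^ k)⁻¹ • g (xs k)) l (nhds (f y))

theorem exists_isBlowdown {d : ℕ} {l : Ultrafilter ℕ} (hl : (l : Filter ℕ) ≤ atTop)
    {X : Set (Euc d)} {s : ℝ} (hX : ∀ z : Euc d, ∃ x ∈ X, dist z x ≤ s) {g : Euc d → Euc d}
    {W : ℝ → ℝ} (hW : Continuous W) (hmono : Monotone W) (hW0 : W 0 = 0)
    (h : HomBound W X g id) : ∃ f, IsBlowdown l X g f := by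
  have key : ∀ y : Euc d, ∃ v : Euc d, ∀ xs : ℕ → Euc d, (∀ k, xs k ∈ X) →
      Tendsto (fun k => ((4 : ℝ) ^ k)⁻¹ • xs k) l (nhds y) →
      Tendsto (fun k => ((4 : ℝ) ^ k)⁻¹ • g (xs k)) l (nhds v) := by
    intro y
    obtain ⟨ps, hpX, hp⟩ := exists_tendsto_scaled_net hX y
    obtain ⟨x₀, hx₀, -⟩ := hX 0
    replace hp := hp.mono_left hl
    have hR : 0 < ‖y‖ + 1 := by positivity
    have hclose : ∀ xs : ℕ → Euc d, (∀ k, xs k ∈ X) →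
        Tendsto (fun k => ((4 : ℝ) ^ k)⁻¹ • xs k) l (nhds y) →
        ∀ᶠ k in (l : Filter ℕ), ‖((4 : ℝ) ^ k)⁻¹ • xs k‖ < ‖y‖ + 1 := fun xs _ hy =>
      hy.norm.eventually (gt_mem_nhds (by linarith))
    have hx₀s : ∀ᶠ k in (l : Filter ℕ), ‖((4 : ℝ) ^ k)⁻¹ • x₀‖ < ‖y‖ + 1 := by
      have h1 : Tendsto (fun k : ℕ => ((4 : ℝ) ^ k)⁻¹ • x₀) l (nhds ((0 : ℝ) • x₀)) :=
        (tendsto_four_pow_inv.mono_left hl).smul_const x₀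
      refine h1.norm.eventually (gt_mem_nhds ?_)
      simpa using hR
    set D := ‖g x₀‖ + (‖y‖ + 1) * W 2 with hD
    have hbdd : ∀ᶠ k in (l : Filter ℕ), ((4 : ℝ) ^ k)⁻¹ • g (ps k) ∈ closedBall (0 : Euc d) D := by
      filter_upwards [hclose ps hpX hp, hx₀s] with k hk hk0
      have h1 := h.scaled k hR (hpX k) hx₀ hk hk0
      have h2 : W (dist (((4 : ℝ) ^ k)⁻¹ • id (ps k)) (((4 : ℝ) ^ k)⁻¹ • id x₀) / (‖y‖ + 1))
          ≤ W 2 := by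
        refine hmono ?_
        rw [div_le_iff₀ hR]
        have := dist_le_norm_add_norm (((4 : ℝ) ^ k)⁻¹ • ps k) (((4 : ℝ) ^ k)⁻¹ • x₀)
        simp only [id]
        linarith
      have h3 := mul_le_mul_of_nonneg_left h2 hR.le
      have h4 := norm_le_norm_add_norm_sub' (((4 : ℝ) ^ k)⁻¹ • g (ps k)) (((4 : ℝ) ^ k)⁻¹ • g x₀)
      rw [← dist_eq_norm] at h4
      have h5 : ‖((4 : ℝ) ^ k)⁻¹ • g x₀‖ ≤ ‖g x₀‖ := by
        rw [norm_smul, Real.norm_of_nonneg (four_pow_inv_pos k).le]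
        exact mul_le_of_le_one_left (norm_nonneg _) (four_pow_inv_le_one k)
      rw [mem_closedBall_zero_iff]
      linarith
    obtain ⟨v, -, hv⟩ := (isCompact_closedBall (0 : Euc d) D).ultrafilter_le_nhds'
      (l.map fun k => ((4 : ℝ) ^ k)⁻¹ • g (ps k)) hbdd
    have hv' : Tendsto (fun k => ((4 : ℝ) ^ k)⁻¹ • g (ps k)) l (nhds v) := hv
    refine ⟨v, fun xs hxX hx => ?_⟩
    refine hv'.congr_dist ?_
    have h1 : Tendsto (fun k => (‖y‖ + 1) * W (dist (((4 : ℝ) ^ k)⁻¹ • ps k)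
        (((4 : ℝ) ^ k)⁻¹ • xs k) / (‖y‖ + 1))) l (nhds 0) := by
      have := tendsto_const_nhds (x := ‖y‖ + 1) |>.mul ((hW.tendsto _).comp
        ((hp.dist hx).div_const (‖y‖ + 1)))
      simpa [hW0] using this
    refine tendsto_of_tendsto_of_tendsto_of_le_of_le' tendsto_const_nhds h1
      (Eventually.of_forall fun _ => dist_nonneg) ?_
    filter_upwards [hclose ps hpX hp, hclose xs hxX hx] with k hk hk'
    exact h.scaled k hR (hpX k) (hxX k) hk hk'
  choose f hf using key
  exact ⟨f, hf⟩

theorem IsBlowdown.homBound {d : ℕ} {l : Ultrafilter ℕ} (hl : (l : Filter ℕ) ≤ atTop)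
    {X : Set (Euc d)} {s : ℝ} (hX : ∀ z : Euc d, ∃ x ∈ X, dist z x ≤ s) {g f : Euc d → Euc d}
    (hf : IsBlowdown l X g f) {W : ℝ → ℝ} (hW : Continuous W) (h : HomBound W X g id) :
    HomBound W univ f id := by
  intro R hR x _ y _ hx hy
  obtain ⟨xs, hxX, hxs⟩ := exists_tendsto_scaled_net hX x
  obtain ⟨ys, hyX, hys⟩ := exists_tendsto_scaled_net hX y
  replace hxs := hxs.mono_left hl
  replace hys := hys.mono_left hl
  exact h.of_tendsto hW hR hxX hyX hxs hys (hf x xs hxX hxs) (hf y ys hyX hys) hxs hys hx hy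

theorem IsBlowdown.homBound_symm {d : ℕ} {l : Ultrafilter ℕ} (hl : (l : Filter ℕ) ≤ atTop)
    {X : Set (Euc d)} {s : ℝ} (hX : ∀ z : Euc d, ∃ x ∈ X, dist z x ≤ s) {g f : Euc d → Euc d}
    (hf : IsBlowdown l X g f) {W : ℝ → ℝ} (hW : Continuous W) (h : HomBound W X id g) :
    HomBound W univ id f := by
  intro R hR x _ y _ hx hy
  obtain ⟨xs, hxX, hxs⟩ := exists_tendsto_scaled_net hX x
  obtain ⟨ys, hyX, hys⟩ := exists_tendsto_scaled_net hX y
  replace hxs := hxs.mono_left hl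
  replace hys := hys.mono_left hl
  exact h.of_tendsto hW hR hxX hyX hxs hys hxs hys (hf x xs hxX hxs) (hf y ys hyX hys) hx hy

theorem IsBlowdown.map_zero {d : ℕ} {l : Ultrafilter ℕ} (hl : (l : Filter ℕ) ≤ atTop)
    {X : Set (Euc d)} (hX : X.Nonempty) {g f : Euc d → Euc d} (hf : IsBlowdown l X g f) :
    f 0 = 0 := by
  obtain ⟨x₀, hx₀⟩ := hX
  have h : ∀ v : Euc d, Tendsto (fun k : ℕ => ((4 : ℝ) ^ k)⁻¹ • v) l (nhds 0) := fun v => by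
    simpa using (tendsto_four_pow_inv.mono_left hl).smul_const v
  exact tendsto_nhds_unique (hf 0 (fun _ => x₀) (fun _ => hx₀) (h _)) (h _)

theorem HomBound.continuous {d : ℕ} {W : ℝ → ℝ} {f : Euc d → Euc d} (h : HomBound W univ f id)
    (hW : Continuous W) (hW0 : W 0 = 0) : Continuous f := by
  refine continuous_iff_continuousAt.2 fun x => ?_
  rw [ContinuousAt, tendsto_iff_dist_tendsto_zero]
  have hR : 0 < ‖x‖ + 1 := by positivity
  have h1 : Tendsto (fun y => (‖x‖ + 1) * W (dist y x / (‖x‖ + 1))) (nhds x) (nhds 0) := by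
    have : Continuous fun y => (‖x‖ + 1) * W (dist y x / (‖x‖ + 1)) := by fun_prop
    simpa [hW0] using this.tendsto x
  refine tendsto_of_tendsto_of_tendsto_of_le_of_le' tendsto_const_nhds h1
    (Eventually.of_forall fun _ => dist_nonneg) ?_
  have h2 : ∀ᶠ y in nhds x, ‖y‖ < ‖x‖ + 1 :=
    continuous_norm.tendsto x |>.eventually (gt_mem_nhds (by linarith))
  filter_upwards [h2] with y hy
  exact h _ hR y trivial x trivial hy (by linarith)

theorem HomBound.injective {d : ℕ} {W : ℝ → ℝ} {f : Euc d → Euc d} (h : HomBound W univ id f)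
    (hW0 : W 0 = 0) : Function.Injective f := by
  intro x y hxy
  have hR : 0 < ‖x‖ + ‖y‖ + 1 := by positivity
  have := h _ hR x trivial y trivial (by linarith [norm_nonneg y]) (by linarith [norm_nonneg x])
  rw [hxy, dist_self, zero_div, hW0, mul_zero] at this
  exact dist_le_zero.1 this

/-- A map with controlled inverse grows at least linearly. -/
theorem HomBound.exists_linear_growth {d : ℕ} {W : ℝ → ℝ} {X : Set (Euc d)} {g : Euc d → Euc d}
    (h : HomBound W X id g) (hW : Continuous W) (hW0 : W 0 = 0) {x₀ : Euc d} (hx₀ : x₀ ∈ X) :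
    ∃ η, 0 < η ∧ ∀ x ∈ X, 2 * ‖x₀‖ ≤ ‖x‖ → η * ‖x‖ ≤ dist (g x) (g x₀) := by
  have h1 : ∀ᶠ t in nhds (0 : ℝ), W t < 1 / 4 :=
    (hW.tendsto 0).eventually (gt_mem_nhds (by rw [hW0]; norm_num))
  obtain ⟨η, hη, hηW⟩ := Metric.eventually_nhds_iff.1 h1
  refine ⟨η, hη, fun x hx hxx => ?_⟩
  rcases eq_or_ne x 0 with rfl | hx0
  · simp
  have hxp : 0 < ‖x‖ := norm_pos_iff.2 hx0
  by_contra! hcon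
  have h2 := h (2 * ‖x‖) (by positivity) x hx x₀ hx₀ (by linarith) (by linarith)
  have h3 : W (dist (g x) (g x₀) / (2 * ‖x‖)) < 1 / 4 := by
    refine hηW ?_
    rw [Real.dist_eq, sub_zero, abs_of_nonneg (by positivity), div_lt_iff₀ (by positivity)]
    nlinarith
  have h4 := norm_sub_norm_le x x₀
  rw [← dist_eq_norm] at h4
  simp only [id] at h2
  nlinarith

/-- A blow-down is approached uniformly on balls. -/
theorem IsBlowdown.eventually_dist_lt {d : ℕ} {l : Ultrafilter ℕ} {X : Set (Euc d)}
    (hX : X.Nonempty) {g f : Euc d → Euc d} (hf : IsBlowdown l X g f) (hcont : Continuous f)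
    (R : ℝ) {ε : ℝ} (hε : 0 < ε) :
    ∀ᶠ k in (l : Filter ℕ), ∀ x ∈ X, ‖((4 : ℝ) ^ k)⁻¹ • x‖ ≤ R →
      dist (((4 : ℝ) ^ k)⁻¹ • g x) (f (((4 : ℝ) ^ k)⁻¹ • x)) < ε := by
  by_contra hcon
  rw [← Ultrafilter.eventually_not] at hcon
  push Not at hcon
  obtain ⟨x₀, hx₀⟩ := hX
  have hsel : ∀ k : ℕ, ∃ x ∈ X, (∃ x ∈ X, ‖((4 : ℝ) ^ k)⁻¹ • x‖ ≤ R ∧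
      ε ≤ dist (((4 : ℝ) ^ k)⁻¹ • g x) (f (((4 : ℝ) ^ k)⁻¹ • x))) →
      ‖((4 : ℝ) ^ k)⁻¹ • x‖ ≤ R ∧
        ε ≤ dist (((4 : ℝ) ^ k)⁻¹ • g x) (f (((4 : ℝ) ^ k)⁻¹ • x)) := fun k => by
    by_cases hk : ∃ x ∈ X, ‖((4 : ℝ) ^ k)⁻¹ • x‖ ≤ R ∧
      ε ≤ dist (((4 : ℝ) ^ k)⁻¹ • g x) (f (((4 : ℝ) ^ k)⁻¹ • x))
    · obtain ⟨x, hx, hx'⟩ := hk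
      exact ⟨x, hx, fun _ => hx'⟩
    · exact ⟨x₀, hx₀, fun h => absurd h hk⟩
  choose xs hxX hxs using hsel
  have hev : ∀ᶠ k in (l : Filter ℕ), ‖((4 : ℝ) ^ k)⁻¹ • xs k‖ ≤ R ∧
      ε ≤ dist (((4 : ℝ) ^ k)⁻¹ • g (xs k)) (f (((4 : ℝ) ^ k)⁻¹ • xs k)) :=
    hcon.mono fun k hk => hxs k hk
  obtain ⟨y, -, hy⟩ := (isCompact_closedBall (0 : Euc d) R).ultrafilter_le_nhds'
    (l.map fun k => ((4 : ℝ) ^ k)⁻¹ • xs k)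
    (hev.mono fun k hk => mem_closedBall_zero_iff.2 hk.1)
  have hy' : Tendsto (fun k => ((4 : ℝ) ^ k)⁻¹ • xs k) l (nhds y) := hy
  have h1 := (hf y xs hxX hy').dist ((hcont.tendsto y).comp hy')
  rw [dist_self] at h1
  obtain ⟨k, hk1, hk2⟩ := (hev.and (h1.eventually (gt_mem_nhds hε))).exists
  exact absurd hk2 (not_lt.2 hk1.2)

theorem tsum_eq_tsum_indicator_of_bijOn {d : ℕ} {S : Set (Fin d → ℤ)} {g : Euc d → Euc d}
    (hg : BijOn g (latEmb '' S) (range latEmb)) (φ : Euc d → ℝ) :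
    ∑' z, φ (latEmb z) = ∑' z, S.indicator 1 z * φ (g (latEmb z)) := by
  have h : ∀ z : S, ∃ w : Fin d → ℤ, latEmb w = g (latEmb z) := fun z =>
    hg.mapsTo ⟨z, z.2, rfl⟩
  choose e he using h
  have hbij : Function.Bijective e := by
    refine ⟨fun z w hzw => ?_, fun w => ?_⟩
    · have h1 : g (latEmb z) = g (latEmb w) := by rw [← he, ← he, hzw]
      exact Subtype.ext (latEmb_injective (hg.injOn ⟨z, z.2, rfl⟩ ⟨w, w.2, rfl⟩ h1))
    · obtain ⟨_, ⟨z, hz, rfl⟩, hzw⟩ := hg.surjOn ⟨w, rfl⟩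
      exact ⟨⟨z, hz⟩, latEmb_injective (by rw [he, hzw])⟩
  rw [← (Equiv.ofBijective e hbij).tsum_eq fun z => φ (latEmb z)]
  simp only [Equiv.ofBijective_apply, he]
  rw [tsum_subtype S fun z => φ (g (latEmb z))]
  congr 1
  funext z
  by_cases hz : z ∈ S <;> simp [hz]

/-- A blow-down of a bijection from a net of asymptotic density `P` onto the lattice transports the
density `P` to Lebesgue measure, tested on compactly supported functions. -/
theorem IsBlowdown.integral_eq {d : ℕ} {l : Ultrafilter ℕ} (hl : (l : Filter ℕ) ≤ atTop)
    (i₀ : Fin d) {P : Euc d → ℝ} (hP : Measurable P) (hP1 : ∀ x, |P x| ≤ 1)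
    (hinv : ∀ (k : ℕ) x, P ((4 : ℝ) ^ k • x) = P x)
    {S : Set (Fin d → ℤ)} {s : ℝ} (hX : ∀ z : Euc d, ∃ x ∈ latEmb '' S, dist z x ≤ s)
    {G : (Fin d → ℤ) → ℝ} (hG : ∀ z, |G z| ≤ 1)
    (hSG : ∀ z, S.indicator 1 z - (∫ x in latFloor ⁻¹' {z}, P x) = G z - G (z + Pi.single i₀ 1))
    {g f : Euc d → Euc d} (hg : BijOn g (latEmb '' S) (range latEmb))
    (hf : IsBlowdown l (latEmb '' S) g f) {W₁ W₂ : ℝ → ℝ} (hW₁ : Continuous W₁)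
    (hW₁0 : W₁ 0 = 0) (hW₂ : Continuous W₂) (hW₂0 : W₂ 0 = 0)
    (h₁ : HomBound W₁ (latEmb '' S) g id) (h₂ : HomBound W₂ (latEmb '' S) id g)
    {ψ : Euc d → ℝ} (hψ : Continuous ψ) (hc : HasCompactSupport ψ) :
    ∫ x, ψ x = ∫ x, P x * ψ (f x) := by
  obtain ⟨x₀, hx₀, -⟩ := hX 0
  have hfc : Continuous f := (hf.homBound hl hX hW₁ h₁).continuous hW₁ hW₁0
  have hf0 : f 0 = 0 := hf.map_zero hl ⟨x₀, hx₀⟩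
  obtain ⟨η, hη, hηf⟩ := (hf.homBound_symm hl hX hW₂ h₂).exists_linear_growth hW₂ hW₂0
    (mem_univ (0 : Euc d))
  obtain ⟨η', hη', hηg⟩ := h₂.exists_linear_growth hW₂ hW₂0 hx₀
  obtain ⟨r, hr, hsupp⟩ := exists_bound_of_hasCompactSupport hc
  have hfz : ∀ x, r / η < ‖x‖ → ψ (f x) = 0 := fun x hx => by
    have h1 := hηf x trivial (by simp)
    rw [hf0, dist_zero_right] at h1
    rw [div_lt_iff₀ hη] at hx
    exact hsupp _ (by linarith)
  have hfcs : HasCompactSupport (ψ ∘ f) := by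
    refine HasCompactSupport.of_support_subset_isCompact (isCompact_closedBall 0 (r / η))
      fun x hx => ?_
    by_contra hcon
    exact hx (hfz x (by simpa using hcon))
  set R := max (r / η) (max (2 * ‖x₀‖) ((r + ‖g x₀‖) / η')) with hRdef
  have hgz : ∀ (k : ℕ), ∀ x ∈ latEmb '' S, R < ‖((4 : ℝ) ^ k)⁻¹ • x‖ →
      ψ (((4 : ℝ) ^ k)⁻¹ • g x) = 0 := by
    intro k x hx hxR
    refine hsupp _ ?_
    have hR1 : 2 * ‖x₀‖ ≤ R := (le_max_left _ _).trans (le_max_right _ _)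
    have hR2 : (r + ‖g x₀‖) / η' ≤ R := (le_max_right _ _).trans (le_max_right _ _)
    have hn : ∀ v : Euc d, ‖((4 : ℝ) ^ k)⁻¹ • v‖ = ((4 : ℝ) ^ k)⁻¹ * ‖v‖ := fun v => by
      rw [norm_smul, Real.norm_of_nonneg (four_pow_inv_pos k).le]
    have hle : ∀ v : Euc d, ((4 : ℝ) ^ k)⁻¹ * ‖v‖ ≤ ‖v‖ := fun v =>
      mul_le_of_le_one_left (norm_nonneg _) (four_pow_inv_le_one k)
    rw [hn] at hxR
    have h1 := hηg x hx (by linarith [hle x])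
    have h2 := dist_le_norm_add_norm (g x) (g x₀)
    have h3 := mul_le_mul_of_nonneg_left (h1.trans h2) (four_pow_inv_pos k).le
    have h4 := hle (g x₀)
    rw [div_le_iff₀ hη'] at hR2
    rw [hn]
    nlinarith
  have hA := (tendsto_scaled_tsum_weighted (P := fun _ : Euc d => (1 : ℝ)) measurable_const
    (B := 1) (by simp) (by simp) hψ hc).mono_left hl
  simp only [integral_const, measureReal_def, Measure.restrict_apply_univ,
    volume_latFloor_preimage, ENNReal.toReal_one, smul_eq_mul, mul_one, one_mul] at hA
  have hB1 := (tendsto_scaled_tsum_weighted hP hP1 hinv (hψ.comp hfc) hfcs).mono_left hl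
  have hB2 := (tendsto_scaled_tsum_coboundary i₀ hG hSG (hψ.comp hfc) hfcs).mono_left hl
  have hB : Tendsto (fun k : ℕ => ((4 : ℝ) ^ k)⁻¹ ^ d *
      ∑' z, S.indicator 1 z * ψ (f (((4 : ℝ) ^ k)⁻¹ • latEmb z))) l
      (nhds (∫ x, P x * ψ (f x))) := by
    have := hB1.add hB2
    rw [add_zero] at this
    refine this.congr fun k => ?_
    have hz : ∀ z, r / η < ‖((4 : ℝ) ^ k)⁻¹ • latEmb z‖ →
        (ψ ∘ f) (((4 : ℝ) ^ k)⁻¹ • latEmb z) = 0 := fun z hz => hfz _ hz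
    rw [← mul_add, ← Summable.tsum_add]
    · congr 2
      funext z
      simp only [Function.comp]
      ring
    · exact summable_of_hasFiniteSupport (finite_support_of_scaled (R := r / η) (k := k)
        fun z hzz => by rw [hz z hzz, mul_zero])
    · exact summable_of_hasFiniteSupport (finite_support_of_scaled (R := r / η) (k := k)
        fun z hzz => by rw [hz z hzz, mul_zero])
  set V := volume.real (closedBall (0 : Euc d) (R + d))
  have hV : 0 ≤ V := measureReal_nonneg
  have huc := Metric.uniformContinuous_iff.1 (hc.uniformContinuous_of_continuous hψ)
  refine tendsto_nhds_unique hA (hB.congr_dist ?_)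
  rw [Metric.tendsto_nhds]
  intro ε hε
  obtain ⟨κ, hκ, hκψ⟩ := huc (ε / (V + 1)) (by positivity)
  filter_upwards [hf.eventually_dist_lt ⟨x₀, hx₀⟩ hfc R hκ] with k hk
  have hz1 : ∀ z, R < ‖((4 : ℝ) ^ k)⁻¹ • latEmb z‖ →
      S.indicator 1 z * ψ (((4 : ℝ) ^ k)⁻¹ • g (latEmb z)) = 0 := fun z hz => by
    by_cases hzS : z ∈ S
    · rw [hgz k _ ⟨z, hzS, rfl⟩ hz, mul_zero]
    · simp [hzS]
  have hz2 : ∀ z, R < ‖((4 : ℝ) ^ k)⁻¹ • latEmb z‖ →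
      S.indicator 1 z * ψ (f (((4 : ℝ) ^ k)⁻¹ • latEmb z)) = 0 := fun z hz => by
    rw [hfz _ ((le_max_left _ _).trans_lt hz), mul_zero]
  rw [Real.dist_eq, sub_zero, abs_of_nonneg dist_nonneg, Real.dist_eq, ← mul_sub,
    tsum_eq_tsum_indicator_of_bijOn hg fun x => ψ (((4 : ℝ) ^ k)⁻¹ • x), ← Summable.tsum_sub
      (summable_of_hasFiniteSupport (finite_support_of_scaled hz2))
      (summable_of_hasFiniteSupport (finite_support_of_scaled hz1))]
  refine (abs_scaled_tsum_le (R := R) (ε := ε / (V + 1)) (fun z hz => ?_)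
    fun z => ?_).trans_lt ?_
  · rw [hz1 z hz, hz2 z hz, sub_zero]
  · by_cases hzS : z ∈ S
    · rcases lt_or_ge R ‖((4 : ℝ) ^ k)⁻¹ • latEmb z‖ with hz | hz
      · rw [hz1 z hz, hz2 z hz, sub_zero, abs_zero]
        positivity
      · have := hκψ (hk _ ⟨z, hzS, rfl⟩ hz)
        rw [dist_comm, Real.dist_eq] at this
        simpa [hzS] using this.le
    · simp only [hzS, not_false_eq_true, indicator_of_notMem, zero_mul, sub_zero, abs_zero]
      positivity
  · change ε / (V + 1) * V < ε
    rw [div_mul_eq_mul_div, div_lt_iff₀ (by positivity)]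
    nlinarith

theorem IsBlowdown.map_withDensity_eq_volume {d : ℕ} {l : Ultrafilter ℕ}
    (hl : (l : Filter ℕ) ≤ atTop) (i₀ : Fin d) {P : Euc d → ℝ} (hP : Measurable P)
    (hP0 : ∀ x, 0 ≤ P x) (hP1 : ∀ x, P x ≤ 1) (hinv : ∀ (k : ℕ) x, P ((4 : ℝ) ^ k • x) = P x)
    {S : Set (Fin d → ℤ)} {s : ℝ} (hX : ∀ z : Euc d, ∃ x ∈ latEmb '' S, dist z x ≤ s)
    {G : (Fin d → ℤ) → ℝ} (hG : ∀ z, |G z| ≤ 1)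
    (hSG : ∀ z, S.indicator 1 z - (∫ x in latFloor ⁻¹' {z}, P x) = G z - G (z + Pi.single i₀ 1))
    {g f : Euc d → Euc d} (hg : BijOn g (latEmb '' S) (range latEmb))
    (hf : IsBlowdown l (latEmb '' S) g f) {W₁ W₂ : ℝ → ℝ} (hW₁ : Continuous W₁)
    (hW₁0 : W₁ 0 = 0) (hW₂ : Continuous W₂) (hW₂0 : W₂ 0 = 0)
    (h₁ : HomBound W₁ (latEmb '' S) g id) (h₂ : HomBound W₂ (latEmb '' S) id g) :
    Measure.map f (volume.withDensity fun x => ENNReal.ofReal (P x)) = volume := by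
  obtain ⟨x₀, hx₀, -⟩ := hX 0
  have hfc : Continuous f := (hf.homBound hl hX hW₁ h₁).continuous hW₁ hW₁0
  have hf0 : f 0 = 0 := hf.map_zero hl ⟨x₀, hx₀⟩
  obtain ⟨η, hη, hηf⟩ := (hf.homBound_symm hl hX hW₂ h₂).exists_linear_growth hW₂ hW₂0
    (mem_univ (0 : Euc d))
  have hfin : IsFiniteMeasureOnCompacts
      (Measure.map f (volume.withDensity fun x => ENNReal.ofReal (P x))) := by
    refine ⟨fun K hK => ?_⟩
    obtain ⟨r, hr⟩ := hK.isBounded.exists_norm_le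
    rw [Measure.map_apply hfc.measurable hK.measurableSet]
    have hsub : f ⁻¹' K ⊆ closedBall 0 (r / η) := fun x hx => by
      have h1 := hηf x trivial (by simp)
      rw [hf0, dist_zero_right] at h1
      rw [mem_closedBall_zero_iff, le_div_iff₀ hη]
      linarith [hr _ hx]
    have hle : (volume.withDensity fun x => ENNReal.ofReal (P x)) ≤ (volume : Measure (Euc d)) := by
      refine (withDensity_mono (ae_of_all _ fun x => ?_)).trans_eq withDensity_one
      simpa using hP1 x
    exact (hle _).trans_lt ((measure_mono hsub).trans_lt measure_closedBall_lt_top)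
  refine Measure.ext_of_integral_eq_on_compactlySupported fun ψ => ?_
  have hψ : Continuous fun x => ψ x := map_continuous ψ
  rw [integral_map hfc.aemeasurable hψ.aestronglyMeasurable,
    hf.integral_eq hl i₀ hP (fun x => by rw [abs_of_nonneg (hP0 x)]; exact hP1 x) hinv hX hG hSG hg
      hW₁ hW₁0 hW₂ hW₂0 h₁ h₂ hψ ψ.hasCompactSupport,
    integral_withDensity_eq_integral_toReal_smul (by fun_prop) (by simp)]
  simp only [ENNReal.toReal_ofReal (hP0 _), smul_eq_mul]

/-- The modulus `ω`, cut off at `a / 2` and extended by `0` to the left of the origin. -/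
def truncModulus (ω : ℝ → ℝ) (a t : ℝ) : ℝ := if t ≤ 0 then 0 else ω (min t (a / 2))

theorem truncModulus_zero (ω : ℝ → ℝ) (a : ℝ) : truncModulus ω a 0 = 0 := by simp [truncModulus]

theorem MemM.half_mem {ω : ℝ → ℝ} {a : ℝ} (h : MemM ω a) : a / 2 ∈ Ioo 0 a :=
  ⟨by linarith [h.a_pos], by linarith [h.a_pos]⟩

theorem MemM.min_mem {ω : ℝ → ℝ} {a : ℝ} (h : MemM ω a) {t : ℝ} (ht : 0 < t) :
    min t (a / 2) ∈ Ioo 0 a :=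
  ⟨lt_min ht h.half_mem.1, (min_le_right _ _).trans_lt h.half_mem.2⟩

theorem MemM.monotone_truncModulus {ω : ℝ → ℝ} {a : ℝ} (h : MemM ω a) :
    Monotone (truncModulus ω a) := by
  intro s t hst
  unfold truncModulus
  split_ifs with hs ht ht
  · exact le_rfl
  · exact (h.pos _ (h.min_mem (not_le.1 ht))).le
  · exact absurd (hst.trans ht) hs
  · exact h.mono.monotoneOn (h.min_mem (not_le.1 hs)) (h.min_mem (not_le.1 ht))
      (min_le_min_right _ hst)

theorem MemM.continuousOn {ω : ℝ → ℝ} {a : ℝ} (h : MemM ω a) : ContinuousOn ω (Ioo 0 a) :=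
  h.concave.continuousOn isOpen_Ioo

theorem MemM.continuous_truncModulus {ω : ℝ → ℝ} {a : ℝ} (h : MemM ω a) :
    Continuous (truncModulus ω a) := by
  refine continuous_iff_continuousAt.2 fun t => ?_
  rcases lt_trichotomy t 0 with ht | rfl | ht
  · refine (continuousAt_const (y := (0 : ℝ))).congr ?_
    filter_upwards [Iio_mem_nhds ht] with s hs
    rw [truncModulus, if_pos (le_of_lt hs)]
  · refine continuousAt_iff_continuous_left'_right'.2 ⟨?_, ?_⟩
    · refine (continuousWithinAt_const (b := (0 : ℝ))).congr (fun s hs => ?_)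
        (truncModulus_zero _ _)
      rw [truncModulus, if_pos (le_of_lt hs)]
    · rw [ContinuousWithinAt, truncModulus_zero]
      refine h.tendsto_zero.congr' ?_
      filter_upwards [Ioo_mem_nhdsGT h.half_mem.1] with s hs
      rw [truncModulus, if_neg (not_le.2 hs.1), min_eq_left hs.2.le]
  · have h1 : ContinuousAt (fun s => ω (min s (a / 2))) t :=
      ContinuousAt.comp (f := fun s => min s (a / 2)) (g := ω)
        (h.continuousOn.continuousAt (isOpen_Ioo.mem_nhds (h.min_mem ht))) (by fun_prop)
    refine h1.congr ?_
    filter_upwards [Ioi_mem_nhds ht] with s hs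
    rw [truncModulus, if_neg (not_le.2 hs)]

theorem MemM.truncModulus_of_le {ω : ℝ → ℝ} {a : ℝ} {t : ℝ} (ht : 0 < t)
    (hta : t ≤ a / 2) : truncModulus ω a t = ω t := by
  rw [truncModulus, if_neg (not_le.2 ht), min_eq_left hta]

theorem MemM.truncModulus_mul_le {ω : ℝ → ℝ} {a : ℝ} (h : MemM ω a) {s b : ℝ}
    (hs : s ∈ Ioo 0 a) (hb : 0 < b) : truncModulus ω a (b * s) ≤ max 1 (2 * b) * ω s := by
  have hbs : 0 < b * s := mul_pos hb hs.1
  rw [truncModulus, if_neg (not_le.2 hbs)]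
  have ht := h.min_mem hbs
  have hle : min (b * s) (a / 2) ≤ b * s := min_le_left _ _
  generalize min (b * s) (a / 2) = t at ht hle
  have hω := h.pos s hs
  rcases le_or_gt t s with hts | hts
  · exact (h.mono.monotoneOn ht hs hts).trans (le_mul_of_one_le_left hω.le (le_max_left _ _))
  · have hs0 := hs.1
    have hden : 0 < 2 * t - s := by linarith
    have hm : s / 2 ∈ Ioo 0 a := ⟨by linarith, by linarith [hs.2]⟩
    have hc := h.concave.2 hm ht (show 0 ≤ (2 * t - 2 * s) / (2 * t - s) from
      div_nonneg (by linarith) hden.le) (show 0 ≤ s / (2 * t - s) by positivity)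
      (by field_simp; ring)
    have he : ((2 * t - 2 * s) / (2 * t - s)) • (s / 2) + (s / (2 * t - s)) • t = s := by
      simp only [smul_eq_mul]
      field_simp
      ring
    rw [he] at hc
    simp only [smul_eq_mul] at hc
    have h1 : 0 ≤ (2 * t - 2 * s) / (2 * t - s) * ω (s / 2) :=
      mul_nonneg (div_nonneg (by linarith) hden.le) (h.pos _ hm).le
    have h2 : s / (2 * t - s) * ω t ≤ ω s := by linarith
    rw [div_mul_eq_mul_div, div_le_iff₀ hden] at h2
    have h3 : s * ω t ≤ s * (2 * b * ω s) := by nlinarith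
    exact (le_of_mul_le_mul_left h3 hs0).trans
      (mul_le_mul_of_nonneg_right (le_max_right _ _) hω.le)

/-- Small values of a modulus are attained. -/
theorem MemM.exists_eq {ω : ℝ → ℝ} {a : ℝ} (h : MemM ω a) {y : ℝ} (hy : 0 < y)
    (hya : y ≤ a / 2) : ∃ t, 0 < t ∧ t ≤ a / 2 ∧ ω t = y := by
  have h2 : truncModulus ω a (a / 2) = ω (a / 2) := MemM.truncModulus_of_le h.half_mem.1 le_rfl
  obtain ⟨t, ht, hty⟩ := intermediate_value_Icc h.half_mem.1.le
    h.continuous_truncModulus.continuousOn (show y ∈ Icc _ _ from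
      ⟨by rw [truncModulus_zero]; exact hy.le, by
        rw [h2]; exact hya.trans (h.le_omega _ h.half_mem)⟩)
  have ht0 : 0 < t := by
    by_contra hcon
    rw [truncModulus, if_pos (not_lt.1 hcon)] at hty
    exact hy.ne hty
  exact ⟨t, ht0, ht.2, by rw [← hty, MemM.truncModulus_of_le ht0 ht.2]⟩

theorem MemM.homBound_of_net {d : ℕ} {ω : ℝ → ℝ} {a : ℝ} (h : MemM ω a) {X : Set (Euc d)}
    {g : Euc d → Euc d} {L U : ℝ} (hL : 0 < L)
    (hg : ∀ R : ℝ, 0 < R → ∀ x ∈ X ∩ ball 0 R, ∀ y ∈ X ∩ ball 0 R,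
      (0 < dist y x / R → dist y x / R < a → dist (g y) (g x) ≤ U * R * ω (dist y x / R)) ∧
      (∀ t ∈ Ioo (0:ℝ) a, ω t = dist y x / R → L * R * t ≤ dist (g y) (g x))) :
    HomBound (fun s => U * (4 / a) * truncModulus ω a (s * (a / 4))) X g id ∧
    HomBound (fun s => (4 / a) * truncModulus ω a (s * (a / (4 * L)))) X id g := by
  have ha := h.a_pos
  have hsc : ∀ R : ℝ, 0 < R → ∀ x y : Euc d, ‖x‖ < R → ‖y‖ < R →
      x ∈ ball 0 (4 / a * R) ∧ dist x y / (4 / a * R) ≤ a / 2 := by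
    intro R hR x y hx hy
    have h4 : 1 ≤ 4 / a := by rw [one_le_div ha]; linarith [h.a_le_one]
    constructor
    · rw [mem_ball_zero_iff]
      nlinarith
    · rw [div_le_iff₀ (by positivity)]
      have := dist_le_norm_add_norm x y
      field_simp
      linarith
  refine ⟨fun R hR x hxX y hyX hx hy => ?_, fun R hR x hxX y hyX hx hy => ?_⟩
  all_goals
    rcases eq_or_ne x y with rfl | hxy
    · simp [truncModulus_zero]
    have hd : 0 < dist x y := dist_pos.2 hxy
    have hRa : 0 < 4 / a * R := by positivity
    obtain ⟨hxb, hxa⟩ := hsc R hR x y hx hy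
    obtain ⟨hyb, -⟩ := hsc R hR y x hy hx
    obtain ⟨hg1, hg2⟩ := hg _ hRa y ⟨hyX, hyb⟩ x ⟨hxX, hxb⟩
    have hpos : 0 < dist x y / (4 / a * R) := by positivity
  · refine (hg1 hpos (hxa.trans_lt h.half_mem.2)).trans_eq ?_
    have he : dist (id x) (id y) / R * (a / 4) = dist x y / (4 / a * R) := by
      simp only [id]
      field_simp
    beta_reduce
    rw [he, MemM.truncModulus_of_le hpos hxa]
    ring
  · obtain ⟨t, ht, hta, hωt⟩ := h.exists_eq hpos hxa
    have h1 := hg2 t ⟨ht, hta.trans_lt h.half_mem.2⟩ hωt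
    have h2 : t ≤ dist (g x) (g y) / R * (a / (4 * L)) := by
      rw [div_mul_div_comm, le_div_iff₀ (by positivity)]
      have : L * (4 / a * R) * t = t * (R * (4 * L)) / a := by ring
      rw [this, div_le_iff₀ ha] at h1
      exact h1
    have h3 := h.monotone_truncModulus h2
    rw [MemM.truncModulus_of_le ht hta, hωt] at h3
    calc dist (id x) (id y) = R * (4 / a * (dist x y / (4 / a * R))) := by
          simp only [id]
          field_simp
      _ ≤ _ := by
          beta_reduce
          gcongr

/-- The vector all of whose coordinates are `1`. -/
def onesVec (d : ℕ) : Euc d := WithLp.toLp 2 fun _ => 1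

theorem onesVec_apply {d : ℕ} (i : Fin d) : onesVec d i = 1 := rfl

/-- A density on the unit cube, transplanted to the cube `[1,2]^d`, extends to a density on the
whole space which is invariant under dilation by powers of `4`. -/
theorem exists_dilation_invariant_density {d : ℕ} (i₀ : Fin d) {ρ : Euc d → ℝ}
    (hρ : Measurable ρ) {m M : ℝ} (hm : 0 < m) (hM : 0 < M)
    (hb : ∀ x ∈ unitCube d, m ≤ ρ x ∧ ρ x ≤ M) :
    ∃ (P : Euc d → ℝ) (θ : ℝ), Measurable P ∧ 0 < θ ∧ (∀ x, θ ≤ P x) ∧ (∀ x, P x ≤ 1) ∧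
      (∀ (k : ℕ) x, P ((4 : ℝ) ^ k • x) = P x) ∧
      ∀ x ∈ unitCube d, P (x + onesVec d) = ρ x / M := by
  classical
  set q : Euc d → ℝ := fun x => if x ∈ unitCube d then ρ x / M else 1 with hq
  have hqm : Measurable q :=
    Measurable.ite (isCompact_unitCube d).measurableSet (hρ.div_const M) measurable_const
  set c : ℝ → ℝ := fun t => ((4 : ℝ) ^ ⌊Real.logb 4 t⌋)⁻¹ with hc
  have hcm : Measurable c := by
    have h1 : Measurable fun t : ℝ => ⌊Real.logb 4 t⌋ :=
      Int.measurable_floor.comp (Real.measurable_log.div_const _)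
    exact ((measurable_of_countable fun n : ℤ => ((4 : ℝ) ^ n)⁻¹)).comp h1
  refine ⟨fun x => q (c (x i₀) • x - onesVec d), min 1 (m / M), ?_, by positivity,
    fun x => ?_, fun x => ?_, fun k x => ?_, fun x hx => ?_⟩
  · refine hqm.comp (Measurable.sub_const (Measurable.smul (hcm.comp ?_) measurable_id) _)
    fun_prop
  · simp only [hq]
    split_ifs with h
    · exact (min_le_right _ _).trans (div_le_div_of_nonneg_right (hb _ h).1 hM.le)
    · exact min_le_left _ _
  · simp only [hq]
    split_ifs with h
    · exact (div_le_one hM).2 (hb _ h).2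
    · exact le_rfl
  · rcases eq_or_ne (x i₀) 0 with h0 | h0
    · have hz : ∀ b : ℝ, b • x - onesVec d ∉ unitCube d := fun b hcon => by
        have := (hcon i₀).1
        simp only [PiLp.sub_apply, PiLp.smul_apply, h0, onesVec_apply, smul_zero] at this
        linarith
      simp only [hq, smul_smul, if_neg (hz _)]
    · have h4 : (4 : ℝ) ^ k ≠ 0 := by positivity
      have hck : c ((4 : ℝ) ^ k * x i₀) * (4 : ℝ) ^ k = c (x i₀) := by
        simp only [hc]
        rw [Real.logb_mul h4 h0, Real.logb_pow, Real.logb_self_eq_one (by norm_num), mul_one,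
          Int.floor_natCast_add, zpow_add₀ (by norm_num), zpow_natCast]
        field_simp
      simp only [PiLp.smul_apply, smul_eq_mul, smul_smul, hck]
  · have hx0 := hx i₀
    have hfl : ⌊Real.logb 4 ((x + onesVec d) i₀)⌋ = 0 := by
      simp only [PiLp.add_apply, onesVec_apply]
      rw [Int.floor_eq_zero_iff]
      refine ⟨Real.logb_nonneg (by norm_num) (by linarith [hx0.1]), ?_⟩
      rw [Real.logb_lt_iff_lt_rpow (by norm_num) (by linarith [hx0.1]), Real.rpow_one]
      linarith [hx0.2]
    have hone : c ((x + onesVec d) i₀) = 1 := by simp only [hc, hfl, zpow_zero, inv_one]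
    simp only [hone, one_smul, add_sub_cancel_right, hq, if_pos hx]

theorem intLattice_eq_range (d : ℕ) : intLattice d = range latEmb := by
  ext x
  constructor
  · intro hx
    choose z hz using hx
    exact ⟨z, by ext i; rw [latEmb_apply, hz]⟩
  · rintro ⟨z, rfl⟩ i
    exact ⟨z i, rfl⟩

/-- Every density which is bounded, bounded away from `0` and invariant under dilation by `4` is
transported to Lebesgue measure by a homeomorphism with the modulus coming from bijections of
separated nets onto the lattice. -/
theorem exists_map_withDensity_eq_volume {d : ℕ} (i₀ : Fin d) {ω : ℝ → ℝ} {a : ℝ} (hM : MemM ω a)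
    (hnets : ∀ X : Set (Euc d), IsSeparatedNet X →
      ∃ L U : ℝ, 0 < L ∧ 0 < U ∧ ∃ g : Euc d → Euc d, Set.BijOn g X (intLattice d) ∧
        ∀ R : ℝ, 0 < R → ∀ x ∈ X ∩ ball 0 R, ∀ y ∈ X ∩ ball 0 R,
          (0 < dist y x / R → dist y x / R < a →
            dist (g y) (g x) ≤ U * R * ω (dist y x / R)) ∧
          (∀ t ∈ Ioo (0:ℝ) a, ω t = dist y x / R → L * R * t ≤ dist (g y) (g x)))
    {P : Euc d → ℝ} (hP : Measurable P) {θ : ℝ} (hθ : 0 < θ) (hθP : ∀ x, θ ≤ P x)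
    (hP1 : ∀ x, P x ≤ 1) (hinv : ∀ (k : ℕ) x, P ((4 : ℝ) ^ k • x) = P x) :
    ∃ (f : Euc d → Euc d) (A₁ b₁ A₂ b₂ : ℝ), 0 < A₁ ∧ 0 < b₁ ∧ 0 < A₂ ∧ 0 < b₂ ∧ Continuous f ∧
      HomBound (fun s => A₁ * truncModulus ω a (s * b₁)) univ f id ∧
      HomBound (fun s => A₂ * truncModulus ω a (s * b₂)) univ id f ∧
      Measure.map f (volume.withDensity fun x => ENNReal.ofReal (P x)) = volume := by
  have hPint : ∀ z, IntegrableOn P (latFloor ⁻¹' {z}) := fun z =>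
    IntegrableOn.of_bound (by simp [volume_latFloor_preimage]) hP.aestronglyMeasurable 1
      (ae_of_all _ fun x => by
        rw [Real.norm_of_nonneg (hθ.le.trans (hθP x))]
        exact hP1 x)
  have hconst : ∀ (z : Fin d → ℤ) (b : ℝ), ∫ _ in (latFloor ⁻¹' {z} : Set (Euc d)), b = b :=
    fun z b => by simp [measureReal_def, volume_latFloor_preimage]
  have hcst : ∀ (z : Fin d → ℤ) (b : ℝ),
      IntegrableOn (fun _ => b) (latFloor ⁻¹' {z} : Set (Euc d)) := fun z b =>
    integrableOn_const (by simp [volume_latFloor_preimage])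
  obtain ⟨S, G, hG, hSG, N, hN⟩ := exists_set_of_weight i₀ hθ
    (w := fun z => ∫ x in latFloor ⁻¹' {z}, P x)
    (fun z => by
      rw [← hconst z θ]
      exact integral_mono (hcst z θ) (hPint z) hθP)
    (fun z => by
      rw [← hconst z 1]
      exact integral_mono (hPint z) (hcst z 1) hP1)
  have hX := isSeparatedNet_image_latEmb i₀ hN
  obtain ⟨L, U, hL, hU, g, hg, hgb⟩ := hnets _ hX
  rw [intLattice_eq_range] at hg
  obtain ⟨-, s, -, -, -, hXs⟩ := hX
  obtain ⟨h₁, h₂⟩ := hM.homBound_of_net hL hgb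
  have ha := hM.a_pos
  have hcont : ∀ A b : ℝ, Continuous fun s => A * truncModulus ω a (s * b) := fun A b =>
    continuous_const.mul (hM.continuous_truncModulus.comp (continuous_mul_const b))
  have hzero : ∀ A b : ℝ, A * truncModulus ω a (0 * b) = 0 := fun A b => by
    rw [zero_mul, truncModulus_zero, mul_zero]
  have hl := Nat.hyperfilter_le_atTop
  obtain ⟨f, hf⟩ := exists_isBlowdown hl hXs (hcont _ _)
    (fun s t hst => mul_le_mul_of_nonneg_left (hM.monotone_truncModulus
      (mul_le_mul_of_nonneg_right hst (by positivity))) (by positivity)) (hzero _ _) h₁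
  have hf₁ := hf.homBound hl hXs (hcont _ _) h₁
  exact ⟨f, _, _, _, _, by positivity, by positivity, by positivity, by positivity,
    hf₁.continuous (hcont _ _) (hzero _ _), hf₁, hf.homBound_symm hl hXs (hcont _ _) h₂,
    hf.map_withDensity_eq_volume hl i₀ hP (fun x => hθ.le.trans (hθP x)) hP1 hinv hXs hG hSG hg
      (hcont _ _) (hzero _ _) (hcont _ _) (hzero _ _) h₁ h₂⟩

theorem norm_add_onesVec_lt {d : ℕ} {x : Euc d} (hx : x ∈ unitCube d) :
    ‖x + onesVec d‖ < 2 * d + 1 := by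
  have := norm_le_card_mul (x := x + onesVec d) (b := 2) fun i => by
    rw [PiLp.add_apply, onesVec_apply, abs_le]
    constructor <;> linarith [(hx i).1, (hx i).2]
  linarith

theorem MemM.isBiOmegaMapOn_unitCube {d : ℕ} {ω : ℝ → ℝ} {a : ℝ} (h : MemM ω a)
    {f : Euc d → Euc d} {A₁ b₁ A₂ b₂ κ : ℝ} (hA₁ : 0 < A₁) (hb₁ : 0 < b₁) (hA₂ : 0 < A₂)
    (hb₂ : 0 < b₂) (hκ : 0 < κ)
    (hf₁ : HomBound (fun s => A₁ * truncModulus ω a (s * b₁)) univ f id)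
    (hf₂ : HomBound (fun s => A₂ * truncModulus ω a (s * b₂)) univ id f) :
    IsBiOmegaMapOn ω a (fun x => κ • f (x + onesVec d)) (unitCube d) := by
  have hinj : Function.Injective f := hf₂.injective (by rw [zero_mul, truncModulus_zero, mul_zero])
  set R : ℝ := 2 * d + 1 with hRdef
  have hR : 0 < R := by positivity
  have hdist : ∀ x y, dist (κ • f (x + onesVec d)) (κ • f (y + onesVec d))
      = κ * dist (f (x + onesVec d)) (f (y + onesVec d)) := fun x y => by
    rw [dist_smul₀, Real.norm_of_nonneg hκ.le]
  set K₁ := κ * (R * (A₁ * max 1 (2 * (b₁ / R)))) with hK₁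
  set K₂ := R * (A₂ * max 1 (2 * (b₂ / (κ * R)))) with hK₂
  have hK₁0 : 0 < K₁ := by positivity
  have hK₂0 : 0 < K₂ := by positivity
  refine ⟨fun x _ y _ hxy => ?_, K₁ + K₂, by positivity, fun x hx y hy h0 h1 => ?_,
    fun x hx y hy h0 h1 => ?_⟩
  · exact add_right_cancel (hinj (smul_right_injective _ hκ.ne' hxy))
  · have hb := hf₁ R hR _ trivial _ trivial (norm_add_onesVec_lt hx) (norm_add_onesVec_lt hy)
    simp only [id, dist_add_right] at hb
    have hm := h.truncModulus_mul_le ⟨h0, h1⟩ (div_pos hb₁ hR)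
    rw [div_mul_eq_mul_div, mul_comm, ← div_mul_eq_mul_div] at hm
    have hω := h.pos _ ⟨h0, h1⟩
    simp only [hdist]
    calc κ * dist (f (x + onesVec d)) (f (y + onesVec d))
        ≤ κ * (R * (A₁ * (max 1 (2 * (b₁ / R)) * ω (dist x y)))) := by
          refine mul_le_mul_of_nonneg_left (hb.trans ?_) hκ.le
          gcongr
      _ = K₁ * ω (dist x y) := by rw [hK₁]; ring
      _ ≤ _ := by nlinarith
  · have hb := hf₂ R hR _ trivial _ trivial (norm_add_onesVec_lt hx) (norm_add_onesVec_lt hy)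
    simp only [id, dist_add_right] at hb
    simp only [hdist] at h0 h1 ⊢
    have hm := h.truncModulus_mul_le ⟨h0, h1⟩ (div_pos hb₂ (mul_pos hκ hR))
    have hω := h.pos _ ⟨h0, h1⟩
    generalize dist (f (x + onesVec d)) (f (y + onesVec d)) = t at *
    have he : b₂ / (κ * R) * (κ * t) = t / R * b₂ := by field_simp
    rw [he] at hm
    calc dist x y ≤ R * (A₂ * (max 1 (2 * (b₂ / (κ * R))) * ω (κ * t))) := by
          refine hb.trans ?_
          gcongr
      _ = K₂ * ω (κ * t) := by rw [hK₂]; ring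
      _ ≤ _ := by nlinarith

theorem map_withDensity_unitCube_eq {d : ℕ} {ρ P : Euc d → ℝ} (hP : Measurable P) {κ : ℝ}
    (hκ : 0 < κ) (hρP : ∀ x ∈ unitCube d, P (x + onesVec d) = ρ x / κ ^ d)
    {f : Euc d → Euc d} (hf : Continuous f) (hinj : Function.Injective f)
    (hfP : Measure.map f (volume.withDensity fun x => ENNReal.ofReal (P x)) = volume) :
    Measure.map (fun x => κ • f (x + onesVec d))
        ((volume.restrict (unitCube d)).withDensity fun x => ENNReal.ofReal (ρ x))
      = volume.restrict ((fun x => κ • f (x + onesVec d)) '' unitCube d) := by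
  set f₀ : Euc d → Euc d := fun x => κ • f (x + onesVec d) with hf₀
  have hf₀c : Continuous f₀ := by fun_prop
  have hQ := isCompact_unitCube d
  ext B hB
  set D : Set (Euc d) := (fun y => κ • y) ⁻¹' (B ∩ f₀ '' unitCube d) with hD
  have hmf : Measurable (fun y : Euc d => κ • y) := (continuous_const_smul κ).measurable
  have hDm : MeasurableSet D := hmf (hB.inter (hQ.image hf₀c).measurableSet)
  have hset : f₀ ⁻¹' B ∩ unitCube d = (fun x => x + onesVec d) ⁻¹' (f ⁻¹' D) := by
    ext x
    simp only [hD, mem_inter_iff, mem_preimage, mem_image]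
    refine and_congr Iff.rfl ⟨fun hx => ⟨x, hx, rfl⟩, ?_⟩
    rintro ⟨y, hy, hyx⟩
    rwa [← add_right_cancel (hinj (smul_right_injective _ hκ.ne' hyx))]
  have hsmul : B ∩ f₀ '' unitCube d = (fun y => κ • y) '' D := by
    rw [hD, image_preimage_eq]
    exact fun y => ⟨κ⁻¹ • y, smul_inv_smul₀ hκ.ne' y⟩
  have hTm : MeasurePreserving (fun x : Euc d => x + onesVec d) volume volume :=
    measurePreserving_add_right volume _
  have hmP : Measurable fun x => ENNReal.ofReal (P x) := hP.ennreal_ofReal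
  have hmPT : Measurable fun x => ENNReal.ofReal (P (x + onesVec d)) := hmP.comp hTm.measurable
  have hvol : volume D = ∫⁻ y in f ⁻¹' D, ENNReal.ofReal (P y) := by
    rw [← withDensity_apply _ (hf.measurable hDm), ← Measure.map_apply hf.measurable hDm, hfP]
  rw [Measure.map_apply hf₀c.measurable hB, withDensity_apply _ (hf₀c.measurable hB),
    Measure.restrict_restrict (hf₀c.measurable hB), Measure.restrict_apply hB]
  have hcongr : ∫⁻ x in f₀ ⁻¹' B ∩ unitCube d, ENNReal.ofReal (ρ x)
      = ∫⁻ x in f₀ ⁻¹' B ∩ unitCube d,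
        ENNReal.ofReal (κ ^ d) * ENNReal.ofReal (P (x + onesVec d)) := by
    refine setLIntegral_congr_fun ((hf₀c.measurable hB).inter hQ.measurableSet) fun x hx => ?_
    rw [← ENNReal.ofReal_mul (by positivity), hρP x hx.2, mul_div_cancel₀ _ (by positivity)]
  rw [hcongr, lintegral_const_mul _ hmPT, hset,
    hTm.setLIntegral_comp_preimage (hf.measurable hDm) hmP, ← hvol, hsmul]
  refine Eq.trans ?_ (Measure.addHaar_smul volume κ D).symm
  rw [finrank_euclideanSpace_fin, abs_of_pos (by positivity)]

/-- Let `ω ∈ 𝓜` (on `(0,a)`) be bounded above by a Hölder modulus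
`C t^α` with `α > (d-1)/d` near `0`. Suppose that every separated net `X ⊆ ℝ^d` admits
constants `L, U > 0` and a bijection `g : X → ℤ^d` satisfying
`L R ω⁻¹(‖y-x‖/R) ≤ ‖g y - g x‖ ≤ U R ω(‖y-x‖/R)` for all `x, y ∈ X ∩ B(0,R)`, `R > 0`
(the bounds being imposed only when the argument of `ω`, resp. `ω⁻¹`, lies in its domain;
the lower bound is expressed as: `L R t ≤ ‖g y - g x‖` whenever `t ∈ (0,a)` and
`ω t = ‖y-x‖/R`). Then every measurable density `ρ : I^d → ℝ` with
`0 < inf ρ ≤ sup ρ < ∞` admits an injective bi-`ω`-mapping `f : I^d → ℝ^d` with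
`f_♯(ρ·𝓛) = 𝓛|_{f(I^d)}`. -/
theorem statement_10 (d : ℕ) (hd : 1 ≤ d) (ω : ℝ → ℝ) (a : ℝ) (hM : MemM ω a)
    (δ C α : ℝ) (hδ : 0 < δ) (hC : 0 < C) (hα : ((d : ℝ) - 1) / d < α)
    (hgrow : ∀ t : ℝ, 0 < t → t ≤ δ → t < a → ω t ≤ C * t ^ α)
    (hnets : ∀ X : Set (Euc d), IsSeparatedNet X →
      ∃ L U : ℝ, 0 < L ∧ 0 < U ∧ ∃ g : Euc d → Euc d, Set.BijOn g X (intLattice d) ∧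
        ∀ R : ℝ, 0 < R → ∀ x ∈ X ∩ ball 0 R, ∀ y ∈ X ∩ ball 0 R,
          (0 < dist y x / R → dist y x / R < a →
            dist (g y) (g x) ≤ U * R * ω (dist y x / R)) ∧
          (∀ t ∈ Ioo (0:ℝ) a, ω t = dist y x / R → L * R * t ≤ dist (g y) (g x))) :
    ∀ ρ : Euc d → ℝ, Measurable ρ →
      (∃ m M : ℝ, 0 < m ∧ ∀ x ∈ unitCube d, m ≤ ρ x ∧ ρ x ≤ M) →
      ∃ f : Euc d → Euc d, IsBiOmegaMapOn ω a f (unitCube d) ∧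
        Measure.map f
            ((volume.restrict (unitCube d)).withDensity fun x => ENNReal.ofReal (ρ x))
          = volume.restrict (f '' unitCube d) := by
  rintro ρ hρ ⟨m, M, hm, hb⟩
  have hM₀ : 0 < M := by
    have h0 := hb 0 fun i => by simp
    linarith
  obtain ⟨P, θ, hP, hθ, hθP, hP1, hinv, hPρ⟩ :=
    exists_dilation_invariant_density ⟨0, hd⟩ hρ hm hM₀ hb
  obtain ⟨f, A₁, b₁, A₂, b₂, hA₁, hb₁, hA₂, hb₂, hfc, hf₁, hf₂, hfP⟩ :=
    exists_map_withDensity_eq_volume ⟨0, hd⟩ hM hnets hP hθ hθP hP1 hinv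
  have hκ : 0 < M ^ ((d : ℝ)⁻¹) := Real.rpow_pos_of_pos hM₀ _
  have hκd : (M ^ ((d : ℝ)⁻¹)) ^ d = M := Real.rpow_inv_natCast_pow hM₀.le (by lia)
  exact ⟨_, hM.isBiOmegaMapOn_unitCube hA₁ hb₁ hA₂ hb₂ hκ hf₁ hf₂,
    map_withDensity_unitCube_eq hP hκ (fun x hx => by rw [hκd]; exact hPρ x hx) hfc
      (hf₂.injective (by rw [zero_mul, truncModulus_zero, mul_zero])) hfP⟩
end
end
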